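/- Let N ⊂ ℝ^m be the unit sphere S^{m-1}, let d ≥ 1 and d < p < ∞ with p ≥ 2. There exist ε > 0 and C < ∞ (depending only on d, m, p) such that for every u₀ : ℝ^d → S^{m-1} with ‖u₀‖_{Ḃ^{d/p}_{p,∞}} < ε and every map u : ℝ^d × (0,∞) → S^{m-1} satisfying the Duhamel identity u(·,t) = G(t)u₀ + ∫₀ᵗ G(t-s) ⋆ (u(·,s)|∇u(·,s)|²) ds for all t > 0, such that t ↦ t^{1/2 - d/(2p)} ∇u(t) is continuous from [0,∞) to L^p(ℝ^d) with t^{1/2 - d/(2p)}‖∇u(t)‖_{L^p} → 0 as t ↘ 0, one has ‖u - G(·)u₀‖_X ≤ C ε. -/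

import Mathlib

noncomputable section

open MeasureTheory Real Set Filter
open scoped ENNReal

/-- `ℝ^d` as a Euclidean space. -/
abbrev Ed (d : ℕ) : Type := EuclideanSpace ℝ (Fin d)

/-- The heat kernel `G(x,t) = (4πt)^{-d/2} e^{-|x|²/(4t)}` on `ℝ^d`. -/
def heatKernel (d : ℕ) (t : ℝ) (x : Ed d) : ℝ :=
  (4 * Real.pi * t) ^ (-(d : ℝ) / 2) * Real.exp (-‖x‖ ^ 2 / (4 * t))

/-- Heat extension `G(t) f = G(·,t) ⋆ f`. -/
def heatConv {F : Type} [NormedAddCommGroup F] [NormedSpace ℝ F] (d : ℕ) (t : ℝ)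
    (v : Ed d → F) : Ed d → F :=
  fun x => ∫ y, heatKernel d t (x - y) • v y

/-- The homogeneous Besov norm
`‖v‖_{Ḃ^{d/p}_{p,∞}} = sup_{t>0} t^{1/2-d/(2p)} ‖∇(G(t)v)‖_{L^p}`. -/
def besovNorm (d m : ℕ) (p : ℝ) (v : Ed d → Ed m) : ℝ≥0∞ :=
  ⨆ t : Set.Ioi (0 : ℝ),
    ENNReal.ofReal ((t : ℝ) ^ ((1 : ℝ) / 2 - d / (2 * p))) *
      eLpNorm (fun x => fderiv ℝ (heatConv d (t : ℝ) v) x) (ENNReal.ofReal p) volume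

/-- `|∇f(x)|²`, the squared Frobenius norm of the gradient. -/
def gradFrobSq (d m : ℕ) (f : Ed d → Ed m) (x : Ed d) : ℝ :=
  ∑ i : Fin d, ‖fderiv ℝ f x (EuclideanSpace.single i 1)‖ ^ 2

/-- The space-time `L²` norm of a (time-first) function over the parabolic cylinder
`B_R(x) × (0,R²)`. -/
def cylinderL2 (d : ℕ) {F : Type} [NormedAddCommGroup F]
    (w : ℝ → Ed d → F) (x : Ed d) (R : ℝ) : ℝ≥0∞ :=
  eLpNorm (fun q : ℝ × Ed d => w q.1 q.2) 2
    (((volume : Measure ℝ).restrict (Set.Ioo 0 (R ^ 2))).prod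
      ((volume : Measure (Ed d)).restrict (Metric.ball x R)))

/-- The `X`-norm
`‖u‖_X = sup_{t>0} (‖u(t)‖_{L^∞} + t^{1/2}‖∇u(t)‖_{L^∞})
  + sup_x sup_{R>0} R^{-d/2} ‖∇u‖_{L²(B_R(x)×(0,R²))}`. -/
def Xnorm (d m : ℕ) (u : ℝ → Ed d → Ed m) : ℝ≥0∞ :=
  (⨆ t : Set.Ioi (0 : ℝ),
    (eLpNorm (u (t : ℝ)) ⊤ volume +
      ENNReal.ofReal ((t : ℝ) ^ ((1 : ℝ) / 2)) *
        eLpNorm (fun x => fderiv ℝ (u (t : ℝ)) x) ⊤ volume)) +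
  ⨆ x : Ed d, ⨆ R : Set.Ioi (0 : ℝ),
    ENNReal.ofReal ((R : ℝ) ^ (-(d : ℝ) / 2)) *
      cylinderL2 d (fun s y => fderiv ℝ (u s) y) x (R : ℝ)

/-- The condition that `t ↦ t^{1/2-d/(2p)} ∇u(t)` is continuous from `[0,∞)` to `L^p(ℝ^d)`
and tends to `0` in `L^p` as `t ↘ 0`. -/
def GradContinuousVanishing (d m : ℕ) (p : ℝ) (hp : 1 ≤ p) (u : ℝ → Ed d → Ed m) : Prop :=
  haveI : Fact (1 ≤ ENNReal.ofReal p) := ⟨by simpa using ENNReal.ofReal_le_ofReal hp⟩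
  ∃ g : ℝ → Lp (Ed d →L[ℝ] Ed m) (ENNReal.ofReal p) (volume : Measure (Ed d)),
    ContinuousOn g (Set.Ici 0) ∧ g 0 = 0 ∧
      ∀ t : ℝ, 0 < t →
        (g t : Ed d → Ed d →L[ℝ] Ed m) =ᵐ[volume]
          fun x => (t ^ ((1 : ℝ) / 2 - d / (2 * p))) • fderiv ℝ (u t) x

section

variable {d m : ℕ}

lemma heatKernel_nonneg {t : ℝ} (ht : 0 < t) (x : Ed d) : 0 ≤ heatKernel d t x := by
  unfold heatKernel; positivity

lemma measurable_heatKernel : Measurable fun q : ℝ × Ed d => heatKernel d q.1 q.2 := by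
  unfold heatKernel; fun_prop

/-- The heat kernel with values in `[0, ∞]`. -/
def heatKernelENN (d : ℕ) (t : ℝ) (x : Ed d) : ℝ≥0∞ := ENNReal.ofReal (heatKernel d t x)

lemma measurable_heatKernelENN : Measurable fun q : ℝ × Ed d => heatKernelENN d q.1 q.2 :=
  measurable_heatKernel.ennreal_ofReal

lemma integral_heatKernel {t : ℝ} (ht : 0 < t) : ∫ x : Ed d, heatKernel d t x = 1 := by
  unfold heatKernel
  rw [integral_const_mul]
  have h := GaussianFourier.integral_rexp_neg_mul_sq_norm (V := Ed d) (b := 1 / (4 * t))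
    (by positivity)
  have h2 : ∀ x : Ed d, -‖x‖ ^ 2 / (4 * t) = -(1 / (4 * t)) * ‖x‖ ^ 2 := fun x => by ring
  simp_rw [h2, h]
  rw [finrank_euclideanSpace_fin, show Real.pi / (1 / (4 * t)) = 4 * Real.pi * t by field_simp,
    ← Real.rpow_add (by positivity), neg_div, neg_add_cancel, Real.rpow_zero]

lemma integrable_heatKernel {t : ℝ} (ht : 0 < t) : Integrable (heatKernel d t) := by
  by_contra h
  have := integral_heatKernel (d := d) ht
  rw [integral_undef h] at this
  exact zero_ne_one this

lemma lintegral_heatKernelENN {t : ℝ} (ht : 0 < t) : ∫⁻ x : Ed d, heatKernelENN d t x = 1 := by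
  unfold heatKernelENN
  rw [← ofReal_integral_eq_lintegral_ofReal (integrable_heatKernel ht)
    (Eventually.of_forall fun x => heatKernel_nonneg ht x), integral_heatKernel ht]
  simp

lemma lintegral_heatKernelENN_sub_left {t : ℝ} (ht : 0 < t) (x : Ed d) :
    ∫⁻ y : Ed d, heatKernelENN d t (x - y) = 1 := by
  rw [lintegral_sub_left_eq_self (fun y => heatKernelENN d t y) x, lintegral_heatKernelENN ht]

lemma lintegral_heatKernelENN_sub_right {t : ℝ} (ht : 0 < t) (y : Ed d) :
    ∫⁻ x : Ed d, heatKernelENN d t (x - y) = 1 := by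
  rw [lintegral_sub_right_eq_self (fun y => heatKernelENN d t y) y, lintegral_heatKernelENN ht]

lemma heatKernel_le {t : ℝ} (ht : 0 < t) (x : Ed d) : heatKernel d t x ≤ t ^ (-(d : ℝ) / 2) := by
  have h1 : Real.exp (-‖x‖ ^ 2 / (4 * t)) ≤ 1 := by
    rw [Real.exp_le_one_iff, neg_div]
    exact neg_nonpos.2 (by positivity)
  have h2 : (4 * Real.pi * t) ^ (-(d : ℝ) / 2) ≤ t ^ (-(d : ℝ) / 2) := by
    apply Real.rpow_le_rpow_of_nonpos ht
    · nlinarith [Real.pi_gt_three]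
    · have : (0 : ℝ) ≤ d := by positivity
      linarith
  calc heatKernel d t x ≤ t ^ (-(d : ℝ) / 2) * 1 := by
        unfold heatKernel; gcongr
    _ = _ := mul_one _

lemma abs_exp_sq_sub_le {a b : ℝ} (ha : 0 ≤ a) (hab : a ≤ b) :
    |Real.exp (-a ^ 2 / 4) - Real.exp (-b ^ 2 / 4)| ≤ (b - a) * Real.exp (-a ^ 2 / 8) := by
  have hd : ∀ x ∈ Icc a b, HasDerivWithinAt (fun x : ℝ => Real.exp (-x ^ 2 / 4))
      (Real.exp (-x ^ 2 / 4) * (-(2 * x) / 4)) (Icc a b) x := by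
    intro x _
    have h1 : HasDerivAt (fun x : ℝ => -x ^ 2 / 4) (-(2 * x) / 4) x := by
      simpa using ((hasDerivAt_pow 2 x).neg.div_const 4)
    exact h1.exp.hasDerivWithinAt
  have hb : ∀ x ∈ Icc a b, ‖Real.exp (-x ^ 2 / 4) * (-(2 * x) / 4)‖ ≤ Real.exp (-a ^ 2 / 8) := by
    intro x hx
    have hx0 : 0 ≤ x := ha.trans hx.1
    rw [norm_mul, Real.norm_of_nonneg (Real.exp_nonneg _), Real.norm_eq_abs,
      show -(2 * x) / 4 = -(x / 2) by ring, abs_neg, abs_of_nonneg (by positivity)]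
    have h1 : x / 2 ≤ Real.exp (x ^ 2 / 8) := by
      have := Real.add_one_le_exp (x ^ 2 / 8)
      nlinarith [sq_nonneg (x - 2)]
    calc Real.exp (-x ^ 2 / 4) * (x / 2) ≤ Real.exp (-x ^ 2 / 4) * Real.exp (x ^ 2 / 8) := by
          gcongr
      _ = Real.exp (-x ^ 2 / 8) := by rw [← Real.exp_add]; congr 1; ring
      _ ≤ _ := by
          apply Real.exp_le_exp.2
          have : a ^ 2 ≤ x ^ 2 := by gcongr; exact hx.1
          linarith
  have := (convex_Icc a b).norm_image_sub_le_of_norm_hasDerivWithin_le hd hb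
    (left_mem_Icc.2 hab) (right_mem_Icc.2 hab)
  rw [Real.norm_eq_abs, Real.norm_of_nonneg (by linarith)] at this
  rw [abs_sub_comm]
  linarith

lemma abs_heatKernel_sub_le {t : ℝ} (ht : 0 < t) (z z' : Ed d) :
    |heatKernel d t z - heatKernel d t z'| ≤ 2 ^ ((d : ℝ) / 2) * (t ^ (-(1 / 2) : ℝ) * ‖z - z'‖ *
      (heatKernel d (2 * t) z + heatKernel d (2 * t) z')) := by
  wlog h : ‖z‖ ≤ ‖z'‖ generalizing z z'
  · have := this z' z (le_of_not_ge h)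
    rw [abs_sub_comm, norm_sub_rev, add_comm (heatKernel d (2 * t) z)]
    exact this
  have hst : 0 < √t := Real.sqrt_pos.2 ht
  have hsq : √t ^ 2 = t := Real.sq_sqrt ht.le
  have h1 := abs_exp_sq_sub_le (a := ‖z‖ / √t) (b := ‖z'‖ / √t) (by positivity) (by gcongr)
  have e1 : ∀ w : Ed d, -(‖w‖ / √t) ^ 2 / 4 = -‖w‖ ^ 2 / (4 * t) := fun w => by
    rw [div_pow, hsq]; field_simp
  have e2 : -(‖z‖ / √t) ^ 2 / 8 = -‖z‖ ^ 2 / (4 * (2 * t)) := by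
    rw [div_pow, hsq]; field_simp; ring
  rw [e1, e1, e2] at h1
  have h3 : ‖z'‖ / √t - ‖z‖ / √t ≤ t ^ (-(1 / 2) : ℝ) * ‖z - z'‖ := by
    rw [Real.rpow_neg ht.le, ← Real.sqrt_eq_rpow, ← sub_div, div_eq_inv_mul]
    gcongr
    rw [norm_sub_rev]
    exact norm_sub_norm_le _ _
  have e3 : (4 * Real.pi * t) ^ (-(d : ℝ) / 2) =
      2 ^ ((d : ℝ) / 2) * (4 * Real.pi * (2 * t)) ^ (-(d : ℝ) / 2) := by
    rw [show 4 * Real.pi * (2 * t) = 2 * (4 * Real.pi * t) by ring,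
      Real.mul_rpow (x := 2) (by positivity) (by positivity), ← mul_assoc, ← Real.rpow_add (by positivity)]
    simp [neg_div]
  have h4 := heatKernel_nonneg (d := d) (t := 2 * t) (by positivity) z'
  calc |heatKernel d t z - heatKernel d t z'|
      = (4 * Real.pi * t) ^ (-(d : ℝ) / 2) *
        |Real.exp (-‖z‖ ^ 2 / (4 * t)) - Real.exp (-‖z'‖ ^ 2 / (4 * t))| := by
        unfold heatKernel
        rw [← mul_sub, abs_mul, abs_of_nonneg (by positivity)]
    _ ≤ (4 * Real.pi * t) ^ (-(d : ℝ) / 2) *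
        (t ^ (-(1 / 2) : ℝ) * ‖z - z'‖ * Real.exp (-‖z‖ ^ 2 / (4 * (2 * t)))) := by
        gcongr
        exact h1.trans (by gcongr)
    _ = 2 ^ ((d : ℝ) / 2) * (t ^ (-(1 / 2) : ℝ) * ‖z - z'‖ * (heatKernel d (2 * t) z)) := by
        rw [e3]; unfold heatKernel; ring
    _ ≤ _ := by gcongr; linarith

lemma enorm_heatKernel_sub_le {t : ℝ} (ht : 0 < t) (z z' : Ed d) :
    ‖heatKernel d t z - heatKernel d t z'‖ₑ ≤ ENNReal.ofReal (2 ^ ((d : ℝ) / 2)) *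
      (ENNReal.ofReal (t ^ (-(1 / 2) : ℝ)) * ‖z - z'‖ₑ *
      (heatKernelENN d (2 * t) z + heatKernelENN d (2 * t) z')) := by
  have h2 := heatKernel_nonneg (d := d) (t := 2 * t) (by positivity)
  unfold heatKernelENN
  rw [← ENNReal.ofReal_add (h2 z) (h2 z'), ← ofReal_norm, ← ofReal_norm,
    ← ENNReal.ofReal_mul (by positivity), ← ENNReal.ofReal_mul (by positivity),
    ← ENNReal.ofReal_mul (by positivity)]
  exact ENNReal.ofReal_le_ofReal (abs_heatKernel_sub_le ht z z')

lemma enorm_heatKernel {t : ℝ} (ht : 0 < t) (z : Ed d) :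
    ‖heatKernel d t z‖ₑ = heatKernelENN d t z := by
  rw [← ofReal_norm, Real.norm_of_nonneg (heatKernel_nonneg ht z), heatKernelENN]

end

section

variable {d m : ℕ}

lemma heatKernel_pos {t : ℝ} (ht : 0 < t) (x : Ed d) : 0 < heatKernel d t x := by
  unfold heatKernel; positivity

lemma heatKernel_le_two_mul {t : ℝ} (ht : 0 < t) (x x' : Ed d) (h : ‖x - x'‖ ≤ 1) :
    heatKernel d t x ≤ 2 ^ ((d : ℝ) / 2) * Real.exp (1 / (4 * t)) * heatKernel d (2 * t) x' := by
  have e3 : (4 * Real.pi * t) ^ (-(d : ℝ) / 2) =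
      2 ^ ((d : ℝ) / 2) * (4 * Real.pi * (2 * t)) ^ (-(d : ℝ) / 2) := by
    rw [show 4 * Real.pi * (2 * t) = 2 * (4 * Real.pi * t) by ring,
      Real.mul_rpow (x := 2) (by positivity) (by positivity), ← mul_assoc,
      ← Real.rpow_add (by positivity)]
    simp [neg_div]
  have h1 : -‖x‖ ^ 2 / (4 * t) ≤ 1 / (4 * t) + -‖x'‖ ^ 2 / (4 * (2 * t)) := by
    have h2 : ‖x'‖ ≤ ‖x‖ + 1 := by
      have := norm_sub_norm_le x' x
      rw [norm_sub_rev] at this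
      linarith
    have h3 : ‖x'‖ ^ 2 ≤ (‖x‖ + 1) ^ 2 := by gcongr
    have h4 : 1 / (4 * t) + -‖x'‖ ^ 2 / (4 * (2 * t)) - -‖x‖ ^ 2 / (4 * t) =
        (2 - ‖x'‖ ^ 2 + 2 * ‖x‖ ^ 2) / (8 * t) := by field_simp; ring
    have h5 : 0 ≤ (2 - ‖x'‖ ^ 2 + 2 * ‖x‖ ^ 2) / (8 * t) := by
      apply div_nonneg _ (by positivity)
      nlinarith [sq_nonneg (‖x‖ - 1)]
    linarith
  unfold heatKernel
  rw [e3]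
  calc _ ≤ 2 ^ ((d : ℝ) / 2) * (4 * Real.pi * (2 * t)) ^ (-(d : ℝ) / 2) *
        Real.exp (1 / (4 * t) + -‖x'‖ ^ 2 / (4 * (2 * t))) := by gcongr
    _ = _ := by rw [Real.exp_add]; ring

lemma heatConv_eq_zero {t : ℝ} (ht : 0 < t) {v : Ed d → Ed m}
    (hv : ¬ AEStronglyMeasurable v volume) (x : Ed d) : heatConv d t v x = 0 := by
  apply integral_undef
  intro hi
  apply hv
  have hk : AEStronglyMeasurable (fun y : Ed d => (heatKernel d t (x - y))⁻¹) volume := by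
    have : Measurable fun y : Ed d => (heatKernel d t (x - y))⁻¹ :=
      (measurable_heatKernel.comp (f := fun y : Ed d => (t, x - y)) (by fun_prop)).inv
    exact this.aestronglyMeasurable
  refine (hk.smul hi.aestronglyMeasurable).congr (Eventually.of_forall fun y => ?_)
  simp only [Pi.smul_apply', smul_smul]
  rw [inv_mul_cancel₀ (heatKernel_pos ht _).ne', one_smul]

lemma aestronglyMeasurable_heatKernel_smul {t : ℝ} {v : Ed d → Ed m}
    (hv : AEStronglyMeasurable v volume) (x : Ed d) :
    AEStronglyMeasurable (fun y => heatKernel d t (x - y) • v y) volume := by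
  have : Measurable fun y : Ed d => heatKernel d t (x - y) :=
    measurable_heatKernel.comp (f := fun y : Ed d => (t, x - y)) (by fun_prop)
  exact this.aestronglyMeasurable.smul hv

lemma enorm_heatConv_le {t : ℝ} (ht : 0 < t) (v : Ed d → Ed m) (x : Ed d) :
    ‖heatConv d t v x‖ₑ ≤ ∫⁻ y, heatKernelENN d t (x - y) * ‖v y‖ₑ := by
  refine (enorm_integral_le_lintegral_enorm _).trans_eq ?_
  simp_rw [enorm_smul, enorm_heatKernel ht]

lemma enorm_heatConv_sub_le {t : ℝ} (ht : 0 < t) (v : Ed d → Ed m) (x x' : Ed d) :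
    ‖heatConv d t v x - heatConv d t v x'‖ₑ ≤ ENNReal.ofReal (2 ^ ((d : ℝ) / 2)) *
      (ENNReal.ofReal (t ^ (-(1 / 2) : ℝ)) * ‖x - x'‖ₑ *
      ((∫⁻ y, heatKernelENN d (2 * t) (x - y) * ‖v y‖ₑ) +
        ∫⁻ y, heatKernelENN d (2 * t) (x' - y) * ‖v y‖ₑ)) := by
  by_cases hv : AEStronglyMeasurable v volume
  swap
  · simp [heatConv_eq_zero ht hv]
  by_cases hx : x = x'
  · simp [hx]
  have hxe : ‖x - x'‖ₑ ≠ 0 := by simpa [sub_eq_zero] using hx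
  have c1 : ENNReal.ofReal (2 ^ ((d : ℝ) / 2)) ≠ 0 := by
    simp only [ne_eq, ENNReal.ofReal_eq_zero, not_le]; positivity
  have c2 : ENNReal.ofReal (t ^ (-(1 / 2) : ℝ)) ≠ 0 := by
    simp only [ne_eq, ENNReal.ofReal_eq_zero, not_le]; positivity
  by_cases hfin : ((∫⁻ y, heatKernelENN d (2 * t) (x - y) * ‖v y‖ₑ) +
        ∫⁻ y, heatKernelENN d (2 * t) (x' - y) * ‖v y‖ₑ) = ⊤
  · rw [hfin, ENNReal.mul_top (mul_ne_zero c2 hxe), ENNReal.mul_top c1]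
    exact le_top
  rw [ENNReal.add_eq_top, not_or] at hfin
  have hint : ∀ z : Ed d, (∫⁻ y, heatKernelENN d (2 * t) (z - y) * ‖v y‖ₑ) ≠ ⊤ →
      Integrable (fun y => heatKernel d t (z - y) • v y) volume := by
    intro z hz
    refine ⟨aestronglyMeasurable_heatKernel_smul hv z, ?_⟩
    rw [hasFiniteIntegral_iff_enorm]
    calc ∫⁻ y, ‖heatKernel d t (z - y) • v y‖ₑ
        ≤ ∫⁻ y, ENNReal.ofReal (2 ^ ((d : ℝ) / 2) * Real.exp (1 / (4 * t))) *
          (heatKernelENN d (2 * t) (z - y) * ‖v y‖ₑ) := by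
          apply lintegral_mono
          intro y
          simp only
          rw [enorm_smul, enorm_heatKernel ht, ← mul_assoc]
          gcongr
          unfold heatKernelENN
          rw [← ENNReal.ofReal_mul (by positivity)]
          exact ENNReal.ofReal_le_ofReal (heatKernel_le_two_mul ht _ _ (by simp))
      _ < ⊤ := by
          rw [lintegral_const_mul' _ _ ENNReal.ofReal_ne_top]
          exact ENNReal.mul_lt_top ENNReal.ofReal_lt_top hz.lt_top
  unfold heatConv
  rw [← integral_sub (hint x hfin.1) (hint x' hfin.2)]
  refine (enorm_integral_le_lintegral_enorm _).trans ?_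
  have hm : AEMeasurable (fun y => heatKernelENN d (2 * t) (x - y) * ‖v y‖ₑ) := by
    have : Measurable fun y : Ed d => heatKernelENN d (2 * t) (x - y) :=
      measurable_heatKernelENN.comp (f := fun y : Ed d => (2 * t, x - y)) (by fun_prop)
    exact this.aemeasurable.mul hv.enorm
  rw [← lintegral_add_left' hm, ← lintegral_const_mul' _ _
    (ENNReal.mul_ne_top ENNReal.ofReal_ne_top enorm_ne_top),
    ← lintegral_const_mul' _ _ ENNReal.ofReal_ne_top]
  apply lintegral_mono
  intro y
  simp only
  rw [← sub_smul, enorm_smul]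
  have := enorm_heatKernel_sub_le ht (x - y) (x' - y)
  rw [sub_sub_sub_cancel_right] at this
  calc _ ≤ _ := mul_le_mul_left this _
    _ = _ := by ring

lemma lintegral_heatKernelENN_mul_le {t : ℝ} (ht : 0 < t) {v : Ed d → Ed m}
    (hv : ∀ y, ‖v y‖ = 1) (x : Ed d) :
    ∫⁻ y, heatKernelENN d t (x - y) * ‖v y‖ₑ = 1 := by
  simp_rw [← ofReal_norm, hv, ENNReal.ofReal_one, mul_one]
  exact lintegral_heatKernelENN_sub_left ht x

lemma enorm_heatConv_le_one {t : ℝ} (ht : 0 < t) {v : Ed d → Ed m}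
    (hv : ∀ y, ‖v y‖ = 1) (x : Ed d) : ‖heatConv d t v x‖ₑ ≤ 1 :=
  (enorm_heatConv_le ht v x).trans_eq (lintegral_heatKernelENN_mul_le ht hv x)

lemma enorm_fderiv_heatConv_le {t : ℝ} (ht : 0 < t) {v : Ed d → Ed m}
    (hv : ∀ y, ‖v y‖ = 1) (x : Ed d) :
    ‖fderiv ℝ (heatConv d t v) x‖ₑ ≤
      ENNReal.ofReal (2 * 2 ^ ((d : ℝ) / 2)) * ENNReal.ofReal (t ^ (-(1 / 2) : ℝ)) := by
  rw [← ENNReal.ofReal_mul (by positivity), ← ofReal_norm]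
  apply ENNReal.ofReal_le_ofReal
  have hc : 0 ≤ 2 * 2 ^ ((d : ℝ) / 2) * t ^ (-(1 / 2) : ℝ) := by positivity
  have : LipschitzWith (2 * 2 ^ ((d : ℝ) / 2) * t ^ (-(1 / 2) : ℝ)).toNNReal (heatConv d t v) := by
    intro x x'
    have h := enorm_heatConv_sub_le ht v x x'
    rw [lintegral_heatKernelENN_mul_le (by positivity) hv,
      lintegral_heatKernelENN_mul_le (by positivity) hv] at h
    rw [edist_eq_enorm_sub, edist_eq_enorm_sub]
    refine h.trans_eq ?_
    change _ = ENNReal.ofReal _ * _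
    rw [ENNReal.ofReal_mul (by positivity), ENNReal.ofReal_mul (by positivity)]
    norm_num
    ring
  have h2 := norm_fderiv_le_of_lipschitz ℝ (x₀ := x) this
  rwa [Real.coe_toNNReal _ hc] at h2

lemma differentiable_heatKernel {t : ℝ} : Differentiable ℝ (heatKernel d t) := by
  unfold heatKernel
  have : Differentiable ℝ (fun x : Ed d => ‖x‖ ^ 2) := differentiable_id.norm_sq ℝ
  fun_prop

lemma differentiable_heatConv {t : ℝ} (ht : 0 < t) {v : Ed d → Ed m}
    (hv1 : ∀ y, ‖v y‖ = 1) : Differentiable ℝ (heatConv d t v) := by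
  by_cases hv : AEStronglyMeasurable v volume
  swap
  · rw [show heatConv d t v = fun _ => 0 from funext (heatConv_eq_zero ht hv)]
    fun_prop
  intro x₀
  have hsub : ∀ {s : ℝ}, 0 < s → Integrable (fun y : Ed d => heatKernel d s (x₀ - y)) volume :=
    fun hs => (integrable_heatKernel hs).comp_sub_left x₀
  have key := hasFDerivAt_integral_of_dominated_loc_of_lip' (𝕜 := ℝ) (μ := (volume : Measure (Ed d)))
    (F := fun x y => heatKernel d t (x - y) • v y) (x₀ := x₀)
    (F' := fun y => (fderiv ℝ (heatKernel d t) (x₀ - y)).smulRight (v y))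
    (s := Metric.closedBall x₀ 1)
    (bound := fun y => 2 ^ ((d : ℝ) / 2) * t ^ (-(1 / 2) : ℝ) *
      (2 ^ ((d : ℝ) / 2) * Real.exp (1 / (4 * (2 * t))) * heatKernel d (2 * (2 * t)) (x₀ - y) +
        heatKernel d (2 * t) (x₀ - y)))
    (Metric.closedBall_mem_nhds x₀ one_pos)
    (fun x _ => aestronglyMeasurable_heatKernel_smul hv x)
    ?_ ?_ ?_ ?_ ?_
  · exact key.2.differentiableAt
  · refine (hsub ht).mono (aestronglyMeasurable_heatKernel_smul hv x₀)
      (Eventually.of_forall fun y => ?_)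
    rw [norm_smul, hv1, mul_one]
  · have h1 : AEStronglyMeasurable (fun y : Ed d => fderiv ℝ (heatKernel d t) (x₀ - y)) volume :=
      ((measurable_fderiv ℝ (heatKernel d t)).comp (by fun_prop)).aestronglyMeasurable
    exact (ContinuousLinearMap.smulRightL ℝ (Ed d) (Ed m)).aestronglyMeasurable_comp₂ h1 hv
  · refine Eventually.of_forall fun y x hx => ?_
    rw [← sub_smul, norm_smul, hv1, mul_one, Real.norm_eq_abs]
    refine (abs_heatKernel_sub_le ht _ _).trans ?_
    rw [sub_sub_sub_cancel_right]
    have h3 := heatKernel_le_two_mul (d := d) (t := 2 * t) (by positivity) (x - y) (x₀ - y)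
      (by rw [sub_sub_sub_cancel_right, ← dist_eq_norm]; exact hx)
    calc _ ≤ 2 ^ ((d : ℝ) / 2) * (t ^ (-(1 / 2) : ℝ) * ‖x - x₀‖ * (2 ^ ((d : ℝ) / 2) *
          Real.exp (1 / (4 * (2 * t))) * heatKernel d (2 * (2 * t)) (x₀ - y) +
            heatKernel d (2 * t) (x₀ - y))) := by gcongr
      _ = _ := by ring
  · exact (((hsub (by positivity)).const_mul _).add (hsub (by positivity))).const_mul _
  · refine Eventually.of_forall fun y => ?_
    have h1 : HasFDerivAt (fun x : Ed d => heatKernel d t (x - y))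
        (fderiv ℝ (heatKernel d t) (x₀ - y)) x₀ :=
      (hasFDerivAt_comp_sub y).2 (differentiable_heatKernel (x₀ - y)).hasFDerivAt
    exact h1.smul_const (v y)

end

section

variable {d m : ℕ}

/-- The `L^p` norm of a function with values in `[0, ∞]`. -/
def lpENN {α : Type*} [MeasurableSpace α] (p : ℝ) (μ : Measure α) (f : α → ℝ≥0∞) : ℝ≥0∞ :=
  (∫⁻ x, f x ^ p ∂μ) ^ (1 / p)

lemma lpENN_mono {α : Type*} [MeasurableSpace α] {p : ℝ} (hp : 0 < p) {μ : Measure α}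
    {f g : α → ℝ≥0∞} (h : ∀ᵐ x ∂μ, f x ≤ g x) : lpENN p μ f ≤ lpENN p μ g := by
  unfold lpENN
  gcongr ?_ ^ (1 / p)
  apply lintegral_mono_ae
  filter_upwards [h] with x hx
  gcongr

lemma lpENN_const_mul {α : Type*} [MeasurableSpace α] {p : ℝ} (hp : 0 < p) {μ : Measure α}
    {c : ℝ≥0∞} (hc : c ≠ ⊤) (f : α → ℝ≥0∞) :
    lpENN p μ (fun x => c * f x) = c * lpENN p μ f := by
  unfold lpENN
  simp_rw [ENNReal.mul_rpow_of_nonneg _ _ hp.le]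
  rw [lintegral_const_mul' _ _ (ENNReal.rpow_ne_top_of_nonneg hp.le hc),
    ENNReal.mul_rpow_of_nonneg _ _ (by positivity), one_div, ENNReal.rpow_rpow_inv hp.ne']

lemma lpENN_le_iff {α : Type*} [MeasurableSpace α] {p : ℝ} (hp : 0 < p) {μ : Measure α}
    {f : α → ℝ≥0∞} {c : ℝ≥0∞} : lpENN p μ f ≤ c ↔ ∫⁻ x, f x ^ p ∂μ ≤ c ^ p := by
  unfold lpENN
  rw [one_div, ENNReal.rpow_inv_le_iff hp]

lemma lpENN_add_le {α : Type*} [MeasurableSpace α] {p : ℝ} (hp : 1 ≤ p) {μ : Measure α}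
    {f g : α → ℝ≥0∞} (hf : AEMeasurable f μ) (hg : AEMeasurable g μ) :
    lpENN p μ (fun x => f x + g x) ≤ lpENN p μ f + lpENN p μ g :=
  ENNReal.lintegral_Lp_add_le hf hg hp

lemma lpENN_one_le {α : Type*} [MeasurableSpace α] {p q : ℝ} (hp : 0 < p) (hpq : p ≤ q)
    {μ : Measure α} {f : α → ℝ≥0∞} (hf : AEMeasurable f μ) :
    lpENN p μ f ≤ lpENN q μ f * μ univ ^ (1 / p - 1 / q) := by
  have := eLpNorm'_le_eLpNorm'_mul_rpow_measure_univ (μ := μ) (f := f) hp hpq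
    hf.aestronglyMeasurable
  simpa [eLpNorm', lpENN] using this

/-- Minkowski's integral inequality for a family that is uniformly bounded in `L^p`. -/
lemma lpENN_lintegral_le {α β : Type*} [MeasurableSpace α] [MeasurableSpace β] {p : ℝ}
    (hp : 1 ≤ p) {μ : Measure α} {ν : Measure β} [IsFiniteMeasure μ] [SFinite ν] {φ : α → β → ℝ≥0∞}
    (hφ : Measurable (Function.uncurry φ)) {η : ℝ≥0∞} (h : ∀ᵐ s ∂μ, lpENN p ν (φ s) ≤ η) :
    lpENN p ν (fun x => ∫⁻ s, φ s x ∂μ) ≤ μ univ * η := by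
  have hp0 : 0 < p := by linarith
  rw [lpENN_le_iff hp0]
  have key : ∀ x, (∫⁻ s, φ s x ∂μ) ^ p ≤ μ univ ^ (p - 1) * ∫⁻ s, φ s x ^ p ∂μ := by
    intro x
    have h1 := lpENN_one_le (p := 1) one_pos hp (μ := μ) (f := fun s => φ s x)
      (hφ.comp measurable_prodMk_right).aemeasurable
    unfold lpENN at h1
    simp only [ENNReal.rpow_one, div_one] at h1
    calc (∫⁻ s, φ s x ∂μ) ^ p ≤ ((∫⁻ s, φ s x ^ p ∂μ) ^ (1 / p) * μ univ ^ (1 - 1 / p)) ^ p := by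
          gcongr
      _ = _ := by
          rw [ENNReal.mul_rpow_of_nonneg _ _ hp0.le, ← ENNReal.rpow_mul, ← ENNReal.rpow_mul, mul_comm,
            one_div, inv_mul_cancel₀ hp0.ne', ENNReal.rpow_one]
          congr 2
          field_simp
  calc ∫⁻ x, (∫⁻ s, φ s x ∂μ) ^ p ∂ν ≤ ∫⁻ x, μ univ ^ (p - 1) * ∫⁻ s, φ s x ^ p ∂μ ∂ν :=
        lintegral_mono key
    _ = μ univ ^ (p - 1) * ∫⁻ s, ∫⁻ x, φ s x ^ p ∂ν ∂μ := by
        rw [lintegral_const_mul' _ _ (ENNReal.rpow_ne_top_of_nonneg (by linarith) (measure_ne_top μ _)),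
          lintegral_lintegral_swap]
        exact ((hφ.comp measurable_swap).pow_const p).aemeasurable
    _ ≤ μ univ ^ (p - 1) * ∫⁻ s, η ^ p ∂μ := by
        gcongr 1
        apply lintegral_mono_ae
        filter_upwards [h] with s hs
        exact (lpENN_le_iff hp0).1 hs
    _ = _ := by
        rw [lintegral_const, mul_comm (η ^ p), ← mul_assoc, ENNReal.mul_rpow_of_nonneg _ _ hp0.le]
        congr 1
        nth_rewrite 2 [← ENNReal.rpow_one (μ univ)]
        rw [← ENNReal.rpow_add_of_nonneg _ _ (by linarith) zero_le_one, sub_add_cancel]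

/-- The `p`-mean of `f` with respect to the heat kernel centred at `x`. -/
def gaussMean (d : ℕ) (p t : ℝ) (f : Ed d → ℝ≥0∞) (x : Ed d) : ℝ≥0∞ :=
  (∫⁻ y, heatKernelENN d t (x - y) * f y ^ p) ^ (1 / p)

lemma measurable_heatKernelENN_sub (t : ℝ) (x : Ed d) :
    Measurable fun y : Ed d => heatKernelENN d t (x - y) :=
  measurable_heatKernelENN.comp (f := fun y : Ed d => (t, x - y)) (by fun_prop)

lemma gaussMean_eq {p t : ℝ} {f : Ed d → ℝ≥0∞} (hf : Measurable f) (x : Ed d) :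
    gaussMean d p t f x = lpENN p (volume.withDensity fun y => heatKernelENN d t (x - y)) f := by
  unfold gaussMean lpENN
  rw [lintegral_withDensity_eq_lintegral_mul _ (measurable_heatKernelENN_sub t x)
    (hf.pow_const p)]
  rfl

lemma lintegral_heatKernelENN_mul_mul_le {p t : ℝ} (hp : 2 ≤ p) (ht : 0 < t)
    {f g : Ed d → ℝ≥0∞} (hf : Measurable f) (hg : Measurable g) (x : Ed d) :
    ∫⁻ y, heatKernelENN d t (x - y) * (f y * g y) ≤
      gaussMean d p t f x * gaussMean d p t g x := by
  rw [gaussMean_eq hf, gaussMean_eq hg]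
  set κ := (volume : Measure (Ed d)).withDensity fun y => heatKernelENN d t (x - y) with hκ
  have hκ1 : κ univ = 1 := by
    rw [hκ, withDensity_apply _ MeasurableSet.univ, Measure.restrict_univ,
      lintegral_heatKernelENN_sub_left ht]
  have h1 : ∫⁻ y, heatKernelENN d t (x - y) * (f y * g y) = ∫⁻ y, (f * g) y ∂κ := by
    rw [hκ, lintegral_withDensity_eq_lintegral_mul _ (measurable_heatKernelENN_sub t x)
      (hf.mul hg)]
    rfl
  rw [h1]
  have h2 : ∀ {h : Ed d → ℝ≥0∞}, Measurable h → lpENN 2 κ h ≤ lpENN p κ h := by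
    intro h hh
    simpa [hκ1] using lpENN_one_le (μ := κ) two_pos hp hh.aemeasurable
  calc ∫⁻ y, (f * g) y ∂κ ≤ lpENN 2 κ f * lpENN 2 κ g :=
        ENNReal.lintegral_mul_le_Lp_mul_Lq κ Real.HolderConjugate.two_two hf.aemeasurable
          hg.aemeasurable
    _ ≤ _ := by gcongr <;> exact h2 (by assumption)

lemma gaussMean_le {p t : ℝ} (hp : 0 < p) (ht : 0 < t) (f : Ed d → ℝ≥0∞) (x : Ed d) :
    gaussMean d p t f x ≤ ENNReal.ofReal (t ^ (-(d / (2 * p)) : ℝ)) * lpENN p volume f := by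
  unfold gaussMean lpENN
  have e : ENNReal.ofReal (t ^ (-(d / (2 * p)) : ℝ)) =
      ENNReal.ofReal (t ^ (-(d : ℝ) / 2)) ^ (1 / p) := by
    rw [ENNReal.ofReal_rpow_of_nonneg (by positivity) (by positivity), ← Real.rpow_mul ht.le]
    congr 2
    field_simp
  rw [e, ← ENNReal.mul_rpow_of_nonneg _ _ (by positivity)]
  gcongr ?_ ^ (1 / p)
  rw [← lintegral_const_mul' _ _ ENNReal.ofReal_ne_top]
  gcongr with y
  exact ENNReal.ofReal_le_ofReal (heatKernel_le ht _)

lemma lpENN_gaussMean {p t : ℝ} (hp : 0 < p) (ht : 0 < t) {f : Ed d → ℝ≥0∞}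
    (hf : Measurable f) : lpENN p volume (gaussMean d p t f) = lpENN p volume f := by
  unfold lpENN gaussMean
  simp_rw [one_div, ENNReal.rpow_inv_rpow hp.ne']
  rw [lintegral_lintegral_swap]
  · congr 1
    apply lintegral_congr
    intro y
    have hm : Measurable fun x : Ed d => heatKernelENN d t (x - y) :=
      measurable_heatKernelENN.comp (f := fun x : Ed d => (t, x - y)) (by fun_prop)
    rw [lintegral_mul_const _ hm, lintegral_heatKernelENN_sub_right ht, one_mul]
  · apply Measurable.aemeasurable
    apply Measurable.mul
    · exact measurable_heatKernelENN.comp (f := fun q : Ed d × Ed d => (t, q.1 - q.2))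
        (by fun_prop)
    · exact (hf.comp measurable_snd).pow_const p

end

section

variable {d m : ℕ}

lemma lintegral_Ioo_sub_left (t : ℝ) (f : ℝ → ℝ≥0∞) :
    ∫⁻ s in Ioo 0 t, f (t - s) = ∫⁻ s in Ioo 0 t, f s := by
  rw [← lintegral_indicator measurableSet_Ioo, ← lintegral_indicator measurableSet_Ioo,
    ← lintegral_sub_left_eq_self _ t]
  congr 1
  ext s
  simp only [indicator, mem_Ioo, sub_sub_cancel, sub_pos, sub_lt_self_iff]
  simp only [and_comm]

lemma lintegral_Ioo_rpow {t b : ℝ} (ht : 0 < t) (hb : b < 1) :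
    ∫⁻ s in Ioo 0 t, ENNReal.ofReal (s ^ (-b)) = ENNReal.ofReal (t ^ (1 - b) / (1 - b)) := by
  have hi : IntervalIntegrable (fun s : ℝ => s ^ (-b)) volume 0 t :=
    intervalIntegral.intervalIntegrable_rpow' (by linarith)
  rw [intervalIntegrable_iff_integrableOn_Ioo_of_le ht.le] at hi
  rw [← ofReal_integral_eq_lintegral_ofReal hi
    ((ae_restrict_iff' measurableSet_Ioo).2 (Eventually.of_forall fun s hs =>
      Real.rpow_nonneg hs.1.le _)),
    ← integral_Ioc_eq_integral_Ioo, ← intervalIntegral.integral_of_le ht.le,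
    integral_rpow (Or.inl (by linarith)), Real.zero_rpow (by linarith)]
  congr 1
  ring_nf

lemma exists_lintegral_beta_le {a b : ℝ} (ha0 : 0 ≤ a) (ha : a < 1) (hb0 : 0 ≤ b) (hb : b < 1) :
    ∃ B : ℝ, 0 < B ∧ ∀ t : ℝ, 0 < t →
      ∫⁻ s in Ioo 0 t, ENNReal.ofReal ((t - s) ^ (-a)) * ENNReal.ofReal (s ^ (-b)) ≤
        ENNReal.ofReal B * ENNReal.ofReal (t ^ (1 - a - b)) := by
  have ha1 : 0 < 1 - a := by linarith
  have hb1 : 0 < 1 - b := by linarith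
  refine ⟨(2⁻¹) ^ (-a) / (1 - b) + (2⁻¹) ^ (-b) / (1 - a), by positivity, fun t ht => ?_⟩
  have hpt : ∀ s ∈ Ioo 0 t,
      ENNReal.ofReal ((t - s) ^ (-a)) * ENNReal.ofReal (s ^ (-b)) ≤
      ENNReal.ofReal ((t * 2⁻¹) ^ (-a)) * ENNReal.ofReal (s ^ (-b)) +
        ENNReal.ofReal ((t * 2⁻¹) ^ (-b)) * ENNReal.ofReal ((t - s) ^ (-a)) := by
    intro s hs
    rcases le_total s (t * 2⁻¹) with h | h
    · refine le_add_right ?_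
      gcongr ENNReal.ofReal ?_ * _
      exact Real.rpow_le_rpow_of_nonpos (by positivity) (by linarith) (by linarith)
    · refine le_add_left ?_
      rw [mul_comm]
      gcongr ENNReal.ofReal ?_ * _
      exact Real.rpow_le_rpow_of_nonpos (by positivity) (by linarith) (by linarith)
  refine (setLIntegral_mono' measurableSet_Ioo hpt).trans ?_
  rw [lintegral_add_left (by fun_prop), lintegral_const_mul' _ _ ENNReal.ofReal_ne_top,
    lintegral_const_mul' _ _ ENNReal.ofReal_ne_top,
    lintegral_Ioo_sub_left t (fun s => ENNReal.ofReal (s ^ (-a))), lintegral_Ioo_rpow ht hb,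
    lintegral_Ioo_rpow ht ha, ← ENNReal.ofReal_mul (by positivity),
    ← ENNReal.ofReal_mul (by positivity), ← ENNReal.ofReal_add (by positivity) (by positivity),
    ← ENNReal.ofReal_mul (by positivity)]
  apply ENNReal.ofReal_le_ofReal
  rw [Real.mul_rpow ht.le (by norm_num), Real.mul_rpow ht.le (by norm_num)]
  have e1 : t ^ (1 - a - b) = t ^ (-a) * t ^ (1 - b) := by
    rw [← Real.rpow_add ht]; ring_nf
  have e2 : t ^ (1 - a - b) = t ^ (-b) * t ^ (1 - a) := by
    rw [← Real.rpow_add ht]; ring_nf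
  rw [add_mul]
  nth_rewrite 1 [e1]
  rw [e2]
  apply le_of_eq
  ring

lemma ofReal_rpow_mul {s : ℝ} (hs : 0 < s) (a b : ℝ) :
    ENNReal.ofReal (s ^ a) * ENNReal.ofReal (s ^ b) = ENNReal.ofReal (s ^ (a + b)) := by
  rw [← ENNReal.ofReal_mul (by positivity), ← Real.rpow_add hs]

/-- The potential `∫₀ᵗ (t-s)^{-1/2} G(2(t-s)) ⋆ W(s)² ds`. -/
def heatPotential (d : ℕ) (W : ℝ → Ed d → ℝ≥0∞) (t : ℝ) (x : Ed d) : ℝ≥0∞ :=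
  ∫⁻ s in Ioo 0 t, ENNReal.ofReal ((t - s) ^ (-(1 / 2) : ℝ)) *
    ∫⁻ y, heatKernelENN d (2 * (t - s)) (x - y) * (W s y * W s y)

lemma measurable_gaussMean {p t : ℝ} {b : ℝ → Ed d → ℝ≥0∞}
    (hb : Measurable (Function.uncurry b)) :
    Measurable fun q : ℝ × Ed d => gaussMean d p (2 * (t - q.1)) (b q.1) q.2 := by
  unfold gaussMean
  apply Measurable.pow_const
  apply Measurable.lintegral_prod_right'
    (f := fun z : (ℝ × Ed d) × Ed d =>
      heatKernelENN d (2 * (t - z.1.1)) (z.1.2 - z.2) * b z.1.1 z.2 ^ p)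
  apply Measurable.mul
  · exact measurable_heatKernelENN.comp
      (f := fun z : (ℝ × Ed d) × Ed d => (2 * (t - z.1.1), z.1.2 - z.2)) (by fun_prop)
  · exact (hb.comp (f := fun z : (ℝ × Ed d) × Ed d => (z.1.1, z.2)) (by fun_prop)).pow_const p

lemma measurable_heatPotential_integrand {W : ℝ → Ed d → ℝ≥0∞}
    (hW : Measurable (Function.uncurry W)) (t : ℝ) :
    Measurable fun z : Ed d × ℝ => ENNReal.ofReal ((t - z.2) ^ (-(1 / 2) : ℝ)) *
      ∫⁻ y, heatKernelENN d (2 * (t - z.2)) (z.1 - y) * (W z.2 y * W z.2 y) := by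
  apply Measurable.mul
  · fun_prop
  apply Measurable.lintegral_prod_right'
    (f := fun z : (Ed d × ℝ) × Ed d =>
      heatKernelENN d (2 * (t - z.1.2)) (z.1.1 - z.2) * (W z.1.2 z.2 * W z.1.2 z.2))
  have h1 := hW.comp (f := fun z : (Ed d × ℝ) × Ed d => (z.1.2, z.2)) (by fun_prop)
  refine Measurable.mul ?_ (h1.mul h1)
  exact measurable_heatKernelENN.comp
    (f := fun z : (Ed d × ℝ) × Ed d => (2 * (t - z.1.2), z.1.1 - z.2)) (by fun_prop)

lemma measurable_heatPotential {W : ℝ → Ed d → ℝ≥0∞}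
    (hW : Measurable (Function.uncurry W)) (t : ℝ) : Measurable (heatPotential d W t) :=
  (measurable_heatPotential_integrand hW t).lintegral_prod_right'

/-- The weighted time average of Gaussian means that controls the heat potential. -/
def gaussPotential (d : ℕ) (p : ℝ) (b : ℝ → Ed d → ℝ≥0∞) (t : ℝ) (x : Ed d) : ℝ≥0∞ :=
  ∫⁻ s in Ioo 0 t, (ENNReal.ofReal ((t - s) ^ (-(1 / 2 + d / (2 * p)) : ℝ)) *
    ENNReal.ofReal (s ^ (-(1 / 2 - d / (2 * p)) : ℝ))) * gaussMean d p (2 * (t - s)) (b s) x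

lemma heatKernelENN_conv_mul_le {p τ : ℝ} (hp : 2 ≤ p) (hτ : 0 < τ)
    {f b : Ed d → ℝ≥0∞} (hf : Measurable f) (hb : Measurable b) {A : ℝ≥0∞}
    (h : ∀ y, f y ≤ A + b y) (x : Ed d) :
    ∫⁻ y, heatKernelENN d τ (x - y) * (f y * f y) ≤
      ENNReal.ofReal (τ ^ (-(d / (2 * p)) : ℝ)) * lpENN p volume f *
        (A + gaussMean d p τ b x) := by
  have hp0 : 0 < p := by linarith
  have h1 : gaussMean d p τ f x ≤ A + gaussMean d p τ b x := by
    set κ := (volume : Measure (Ed d)).withDensity fun y => heatKernelENN d τ (x - y) with hκ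
    have hκ1 : κ univ = 1 := by
      rw [hκ, withDensity_apply _ MeasurableSet.univ, Measure.restrict_univ,
        lintegral_heatKernelENN_sub_left hτ]
    rw [gaussMean_eq hf, gaussMean_eq hb, ← hκ]
    calc lpENN p κ f ≤ lpENN p κ (fun y => A + b y) :=
          lpENN_mono hp0 (Eventually.of_forall h)
      _ ≤ lpENN p κ (fun _ => A) + lpENN p κ b :=
          lpENN_add_le (by linarith) (by fun_prop) hb.aemeasurable
      _ = _ := by
          congr 1
          rw [lpENN, lintegral_const, hκ1, mul_one, one_div, ENNReal.rpow_rpow_inv hp0.ne']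
  refine (lintegral_heatKernelENN_mul_mul_le hp hτ hf hf x).trans ?_
  gcongr
  exact gaussMean_le hp0 hτ f x

lemma heatPotential_le {p t : ℝ} (hp : 2 ≤ p)
    {W b : ℝ → Ed d → ℝ≥0∞} (hW : Measurable (Function.uncurry W))
    (hb : Measurable (Function.uncurry b)) {A δ : ℝ≥0∞}
    (hδ : ∀ s ∈ Ioo 0 t, lpENN p volume (W s) ≤
      δ * ENNReal.ofReal (s ^ (-(1 / 2 - d / (2 * p)) : ℝ)))
    (hWb : ∀ s ∈ Ioo 0 t, ∀ y, W s y ≤ A * ENNReal.ofReal (s ^ (-(1 / 2) : ℝ)) + b s y)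
    (x : Ed d) :
    heatPotential d W t x ≤
      δ * (A * ∫⁻ s in Ioo 0 t, ENNReal.ofReal ((t - s) ^ (-(1 / 2 + d / (2 * p)) : ℝ)) *
        ENNReal.ofReal (s ^ (-(1 - d / (2 * p)) : ℝ))) + δ * gaussPotential d p b t x := by
  have hm : Measurable fun s : ℝ => ENNReal.ofReal ((t - s) ^ (-(1 / 2 + d / (2 * p)) : ℝ)) *
        ENNReal.ofReal (s ^ (-(1 - d / (2 * p)) : ℝ)) := by fun_prop
  have hm2 : Measurable fun s : ℝ => (ENNReal.ofReal ((t - s) ^ (-(1 / 2 + d / (2 * p)) : ℝ)) *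
    ENNReal.ofReal (s ^ (-(1 / 2 - d / (2 * p)) : ℝ))) *
      gaussMean d p (2 * (t - s)) (b s) x := by
    refine Measurable.mul (by fun_prop) ?_
    exact (measurable_gaussMean hb).comp (f := fun s : ℝ => (s, x)) (by fun_prop)
  unfold heatPotential gaussPotential
  rw [← lintegral_const_mul _ hm, ← mul_add, ← lintegral_add_left (hm.const_mul A),
    ← lintegral_const_mul _ (by fun_prop)]
  apply setLIntegral_mono' measurableSet_Ioo
  intro s hs
  have hτ : 0 < t - s := sub_pos.2 hs.2
  have hWs : Measurable (W s) := hW.comp (measurable_prodMk_left (x := s))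
  have hbs : Measurable (b s) := hb.comp (measurable_prodMk_left (x := s))
  have h1 := heatKernelENN_conv_mul_le (τ := 2 * (t - s)) hp (by positivity) hWs hbs (hWb s hs) x
  have h2 : ENNReal.ofReal ((2 * (t - s)) ^ (-(d / (2 * p)) : ℝ)) ≤
      ENNReal.ofReal ((t - s) ^ (-(d / (2 * p)) : ℝ)) := by
    apply ENNReal.ofReal_le_ofReal
    apply Real.rpow_le_rpow_of_nonpos hτ (by linarith)
    have : (0 : ℝ) ≤ d / (2 * p) := by positivity
    linarith
  have e1 : ENNReal.ofReal ((t - s) ^ (-(1 / 2 + d / (2 * p)) : ℝ)) =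
      ENNReal.ofReal ((t - s) ^ (-(1 / 2) : ℝ)) *
        ENNReal.ofReal ((t - s) ^ (-(d / (2 * p)) : ℝ)) := by
    rw [ofReal_rpow_mul hτ]; congr 2; ring
  have e2 : ENNReal.ofReal (s ^ (-(1 - d / (2 * p)) : ℝ)) =
      ENNReal.ofReal (s ^ (-(1 / 2 - d / (2 * p)) : ℝ)) *
        ENNReal.ofReal (s ^ (-(1 / 2) : ℝ)) := by
    rw [ofReal_rpow_mul hs.1]; congr 2; ring
  calc _ ≤ ENNReal.ofReal ((t - s) ^ (-(1 / 2) : ℝ)) *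
        (ENNReal.ofReal ((t - s) ^ (-(d / (2 * p)) : ℝ)) *
          (δ * ENNReal.ofReal (s ^ (-(1 / 2 - d / (2 * p)) : ℝ))) *
        (A * ENNReal.ofReal (s ^ (-(1 / 2) : ℝ)) + gaussMean d p (2 * (t - s)) (b s) x)) := by
        gcongr
        refine h1.trans ?_
        gcongr
        exact hδ s hs
    _ = _ := by rw [e1, e2]; ring

lemma lpENN_gaussPotential_le {p t B : ℝ} (hp : 2 ≤ p)
    {b : ℝ → Ed d → ℝ≥0∞} (hb : Measurable (Function.uncurry b)) {η : ℝ≥0∞}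
    (hB : ∫⁻ s in Ioo 0 t, ENNReal.ofReal ((t - s) ^ (-(1 / 2 + d / (2 * p)) : ℝ)) *
      ENNReal.ofReal (s ^ (-(1 - d / p)) : ℝ) ≤
        ENNReal.ofReal B * ENNReal.ofReal (t ^ (-(1 / 2 - d / (2 * p)) : ℝ)))
    (hη : ∀ s ∈ Ioo 0 t, lpENN p volume (b s) ≤
      η * ENNReal.ofReal (s ^ (-(1 / 2 - d / (2 * p)) : ℝ))) :
    lpENN p volume (gaussPotential d p b t) ≤
      ENNReal.ofReal B * ENNReal.ofReal (t ^ (-(1 / 2 - d / (2 * p)) : ℝ)) * η := by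
  have hp0 : 0 < p := by linarith
  have hm : Measurable fun s : ℝ => ENNReal.ofReal ((t - s) ^ (-(1 / 2 + d / (2 * p)) : ℝ)) *
      ENNReal.ofReal (s ^ (-(1 - d / p)) : ℝ) := by fun_prop
  set μ := (volume.restrict (Ioo 0 t)).withDensity fun s : ℝ =>
    ENNReal.ofReal ((t - s) ^ (-(1 / 2 + d / (2 * p)) : ℝ)) *
      ENNReal.ofReal (s ^ (-(1 - d / p)) : ℝ) with hμ
  have hμu : μ univ = ∫⁻ s in Ioo 0 t, ENNReal.ofReal ((t - s) ^ (-(1 / 2 + d / (2 * p)) : ℝ)) *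
      ENNReal.ofReal (s ^ (-(1 - d / p)) : ℝ) := by
    rw [hμ, withDensity_apply _ MeasurableSet.univ, Measure.restrict_univ]
  have : IsFiniteMeasure μ := ⟨by
    rw [hμu]
    exact hB.trans_lt (ENNReal.mul_lt_top ENNReal.ofReal_lt_top ENNReal.ofReal_lt_top)⟩
  have hφ : Measurable (Function.uncurry fun (s : ℝ) (x : Ed d) =>
      ENNReal.ofReal (s ^ ((1 / 2 - d / (2 * p)) : ℝ)) * gaussMean d p (2 * (t - s)) (b s) x) := by
    exact Measurable.mul (by fun_prop) (measurable_gaussMean hb)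
  have h1 : gaussPotential d p b t = fun x => ∫⁻ s,
      ENNReal.ofReal (s ^ ((1 / 2 - d / (2 * p)) : ℝ)) *
        gaussMean d p (2 * (t - s)) (b s) x ∂μ := by
    ext x
    have hx : Measurable (fun s : ℝ => ENNReal.ofReal (s ^ ((1 / 2 - d / (2 * p)) : ℝ)) *
        gaussMean d p (2 * (t - s)) (b s) x) := hφ.comp (measurable_prodMk_right (y := x))
    rw [hμ, lintegral_withDensity_eq_lintegral_mul _ hm hx, gaussPotential]
    apply setLIntegral_congr_fun measurableSet_Ioo
    intro s hs
    simp only [Pi.mul_apply]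
    rw [show ENNReal.ofReal (s ^ (-(1 / 2 - d / (2 * p)) : ℝ)) =
      ENNReal.ofReal (s ^ (-(1 - d / p)) : ℝ) *
        ENNReal.ofReal (s ^ ((1 / 2 - d / (2 * p)) : ℝ)) by
        rw [ofReal_rpow_mul hs.1]; congr 2; field_simp; ring]
    ring
  rw [h1]
  refine (lpENN_lintegral_le (by linarith) hφ (η := η) ?_).trans ?_
  · refine (withDensity_absolutelyContinuous _ _).ae_le
      ((ae_restrict_iff' measurableSet_Ioo).2 (Eventually.of_forall fun s hs => ?_))
    have hbs : Measurable (b s) := hb.comp (measurable_prodMk_left (x := s))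
    have hτ : 0 < t - s := sub_pos.2 hs.2
    rw [lpENN_const_mul hp0 ENNReal.ofReal_ne_top,
      lpENN_gaussMean hp0 (by positivity) hbs]
    calc _ ≤ ENNReal.ofReal (s ^ ((1 / 2 - d / (2 * p)) : ℝ)) *
          (η * ENNReal.ofReal (s ^ (-(1 / 2 - d / (2 * p)) : ℝ))) := by
          gcongr
          exact hη s hs
      _ = η * (ENNReal.ofReal (s ^ ((1 / 2 - d / (2 * p)) : ℝ)) *
          ENNReal.ofReal (s ^ (-(1 / 2 - d / (2 * p)) : ℝ))) := by ring
      _ = η := by rw [ofReal_rpow_mul hs.1]; simp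
  · rw [hμu]
    gcongr

end

section

variable {d m : ℕ}

lemma Lp_ae_tendsto {α E : Type*} [MeasurableSpace α] {μ : Measure α} [NormedAddCommGroup E]
    [CompleteSpace E] {q : ℝ≥0∞} [hq : Fact (1 ≤ q)] (f : ℕ → Lp E q μ) (g : Lp E q μ)
    (h : ∀ n, dist (g) (f n) < (2⁻¹ : ℝ) ^ n) :
    ∀ᵐ x ∂μ, Tendsto (fun n => f n x) atTop (nhds (g x)) := by
  have hdist : ∀ n k, eLpNorm (⇑(f n) - ⇑(f k)) q μ = edist (f n) (f k) := fun n k =>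
    (Lp.edist_def _ _).symm
  have hsum : Summable fun n : ℕ => 2 * (2⁻¹ : ℝ) ^ n :=
    (summable_geometric_of_lt_one (by norm_num) (by norm_num)).mul_left 2
  have h1 : ∀ᵐ x ∂μ, ∃ l : E, Tendsto (fun n => f n x) atTop (nhds l) := by
    refine Lp.ae_tendsto_of_cauchy_eLpNorm (p := q) (fun n => Lp.aestronglyMeasurable _) hq.out
      (B := fun n => ENNReal.ofReal (2 * (2⁻¹ : ℝ) ^ n)) hsum.tsum_ofReal_ne_top ?_
    intro N n k hn hk
    rw [hdist, edist_dist]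
    refine ENNReal.ofReal_lt_ofReal_iff_of_nonneg dist_nonneg |>.2 ?_
    have h2 : ∀ j, N ≤ j → dist g (f j) < (2⁻¹ : ℝ) ^ N := fun j hj =>
      (h j).trans_le (pow_le_pow_of_le_one (by norm_num) (by norm_num) hj)
    calc dist (f n) (f k) ≤ dist g (f n) + dist g (f k) := dist_triangle_left _ _ _
      _ < _ := by linarith [h2 n hn, h2 k hk]
  have hlim : Tendsto f atTop (nhds g) := by
    rw [tendsto_iff_dist_tendsto_zero]
    refine squeeze_zero (fun _ => dist_nonneg) (fun n => ?_)
      (tendsto_pow_atTop_nhds_zero_of_lt_one (r := (2⁻¹ : ℝ)) (by norm_num) (by norm_num))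
    rw [dist_comm]
    exact (h n).le
  obtain ⟨ns, hns, h3⟩ := (tendstoInMeasure_of_tendsto_Lp hlim).exists_seq_tendsto_ae
  filter_upwards [h1, h3] with x ⟨l, hl⟩ hx
  rwa [tendsto_nhds_unique hx (hl.comp hns.tendsto_atTop)]

lemma exists_measurable_enorm_version {α E : Type*} [MeasurableSpace α] {μ : Measure α}
    [NormedAddCommGroup E] [CompleteSpace E] {q : ℝ≥0∞} [hq : Fact (1 ≤ q)]
    [SecondCountableTopology (Lp E q μ)] {g : ℝ → Lp E q μ} (hg : Continuous g) :
    ∃ W : ℝ → α → ℝ≥0∞, Measurable (Function.uncurry W) ∧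
      ∀ s, W s =ᵐ[μ] fun y => ‖g s y‖ₑ := by
  classical
  set D : ℕ → Lp E q μ := TopologicalSpace.denseSeq _ with hD
  have hex : ∀ k : ℕ, ∀ s, ∃ n, dist (g s) (D n) < (2⁻¹ : ℝ) ^ k := fun k s =>
    (TopologicalSpace.denseRange_denseSeq _).exists_dist_lt (g s) (by positivity)
  set N : ℕ → ℝ → ℕ := fun k s => Nat.find (hex k s) with hN
  have hNm : ∀ k, Measurable (N k) := fun k => measurable_find (hex k) fun n =>
    (isOpen_lt (by fun_prop) continuous_const).measurableSet
  refine ⟨fun s y => liminf (fun k => ‖D (N k s) y‖ₑ) atTop, ?_, fun s => ?_⟩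
  · apply Measurable.liminf
    intro k
    have h1 : Measurable fun z : ℕ × α => ‖D z.1 z.2‖ₑ :=
      measurable_from_prod_countable_right fun n => (Lp.stronglyMeasurable (D n)).enorm
    exact h1.comp (f := fun z : ℝ × α => (N k z.1, z.2))
      (((hNm k).comp measurable_fst).prodMk measurable_snd)
  · filter_upwards [Lp_ae_tendsto (fun k => D (N k s)) (g s)
      fun k => Nat.find_spec (hex k s)] with y hy
    exact ((continuous_enorm.tendsto _).comp hy).liminf_eq

end

section

variable {d m : ℕ}

lemma lpENN_enorm {α E : Type*} [MeasurableSpace α] {μ : Measure α} [NormedAddCommGroup E] {p : ℝ}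
    (hp : 0 < p) (f : α → E) :
    lpENN p μ (fun x => ‖f x‖ₑ) = eLpNorm f (ENNReal.ofReal p) μ := by
  rw [eLpNorm_eq_lintegral_rpow_enorm_toReal (by simpa using hp) ENNReal.ofReal_ne_top,
    ENNReal.toReal_ofReal hp.le, lpENN]

lemma lpENN_congr {α : Type*} [MeasurableSpace α] {p : ℝ} (hp : 0 < p) {μ : Measure α}
    {f g : α → ℝ≥0∞} (h : f =ᵐ[μ] g) : lpENN p μ f = lpENN p μ g :=
  le_antisymm (lpENN_mono hp h.le) (lpENN_mono hp h.symm.le)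

lemma GradContinuousVanishing.exists_version {p : ℝ} {hp : 1 ≤ p} {u : ℝ → Ed d → Ed m}
    (h : GradContinuousVanishing d m p hp u) :
    ∃ (W : ℝ → Ed d → ℝ≥0∞) (N : ℝ → ℝ), Measurable (Function.uncurry W) ∧ Continuous N ∧
      N 0 = 0 ∧ ∀ t, 0 < t → W t =ᵐ[volume] (fun x => ‖fderiv ℝ (u t) x‖ₑ) ∧
        lpENN p volume (W t) =
          ENNReal.ofReal (N t) * ENNReal.ofReal (t ^ (-(1 / 2 - d / (2 * p)) : ℝ)) := by
  have hp0 : 0 < p := by linarith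
  obtain ⟨g, hg, hg0, hgt⟩ := h
  have : Fact (1 ≤ ENNReal.ofReal p) := ⟨by simpa using ENNReal.ofReal_le_ofReal hp⟩
  have : Fact (ENNReal.ofReal p ≠ ⊤) := ⟨ENNReal.ofReal_ne_top⟩
  have hgc : Continuous fun s => g (max s 0) :=
    hg.comp_continuous (by fun_prop) fun s => mem_Ici.2 (le_max_right _ _)
  obtain ⟨V, hV, hVg⟩ := exists_measurable_enorm_version hgc
  have key : ∀ t, 0 < t → ∀ᵐ x, ENNReal.ofReal (t ^ (-(1 / 2 - d / (2 * p)) : ℝ)) * V t x =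
      ‖fderiv ℝ (u t) x‖ₑ := by
    intro t ht
    filter_upwards [hVg t, hgt t ht] with x hx hx2
    rw [hx, max_eq_left ht.le, hx2, enorm_smul, Real.enorm_eq_ofReal (by positivity), ← mul_assoc,
      ofReal_rpow_mul ht]
    simp
  refine ⟨fun t x => ENNReal.ofReal (t ^ (-(1 / 2 - d / (2 * p)) : ℝ)) * V t x,
    fun t => ‖g (max t 0)‖, ?_, hgc.norm, by simp [hg0], fun t ht => ⟨key t ht, ?_⟩⟩
  · exact Measurable.mul (by fun_prop) hV
  · rw [lpENN_const_mul hp0 ENNReal.ofReal_ne_top, lpENN_congr hp0 (hVg t), lpENN_enorm hp0,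
      mul_comm]
    congr 1
    rw [← Lp.enorm_def, ← ofReal_norm]

end

section

variable {d m : ℕ}

lemma enorm_clm_zero_le (c : ℝ≥0∞) : ‖(0 : Ed d →L[ℝ] Ed m)‖ₑ ≤ c := by
  rw [← ofReal_norm, norm_zero, ENNReal.ofReal_zero]
  exact zero_le

lemma enorm_clm_add_le (f g : Ed d →L[ℝ] Ed m) : ‖f + g‖ₑ ≤ ‖f‖ₑ + ‖g‖ₑ := by
  simp only [enorm_eq_nnnorm]
  exact_mod_cast nnnorm_add_le f g

lemma ae_norm_fderiv_le_of_lipschitz_on (hd : 1 ≤ d) {f : Ed d → Ed m} {s : Set (Ed d)}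
    (hs : MeasurableSet s) (hf : ∀ x ∈ s, DifferentiableAt ℝ f x) {c : NNReal}
    (h : ∀ x ∈ s, ∀ y ∈ s, ‖f x - f y‖ ≤ c * ‖x - y‖) :
    ∀ᵐ x, x ∈ s → ‖fderiv ℝ f x‖ ≤ m * c := by
  set e : Ed d := EuclideanSpace.single ⟨0, hd⟩ 1 with he
  have hen : ‖e‖ = 1 := by simp [he]
  set L : Fin m → Ed m →L[ℝ] Ed d := fun j =>
    (EuclideanSpace.proj j : Ed m →L[ℝ] ℝ).smulRight e with hL
  have hLn : ∀ j v, ‖L j v‖ = |v j| := fun j v => by simp [hL, norm_smul, hen]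
  have key : ∀ j, ∀ᵐ x ∂(volume.restrict s), ‖(L j).comp (fderiv ℝ f x) - 0‖₊ ≤ c := by
    intro j
    refine ApproximatesLinearOn.norm_fderiv_sub_le volume (f := fun x => L j (f x)) ?_ hs _ ?_
    · intro x hx y hy
      rw [← map_sub, zero_apply, sub_zero, hLn]
      exact (PiLp.norm_apply_le (f x - f y) j).trans (h x hx y hy)
    · intro x hx
      exact ((L j).hasFDerivAt.comp x (hf x hx).hasFDerivAt).hasFDerivWithinAt
  have key2 := (ae_restrict_iff' hs).1 (ae_all_iff.2 key)
  filter_upwards [key2] with x hx hxs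
  refine ContinuousLinearMap.opNorm_le_bound _ (by positivity) fun v => ?_
  calc ‖fderiv ℝ f x v‖ = ‖∑ j, EuclideanSpace.single j (fderiv ℝ f x v j)‖ := by
        congr 1
        ext k
        simp
    _ ≤ ∑ j, ‖EuclideanSpace.single j (fderiv ℝ f x v j)‖ := norm_sum_le _ _
    _ ≤ ∑ _j : Fin m, (c : ℝ) * ‖v‖ := by
        refine Finset.sum_le_sum fun j _ => ?_
        have h1 := hx hxs j
        rw [sub_zero] at h1
        have h2 := ((L j).comp (fderiv ℝ f x)).le_of_opNorm_le h1 v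
        simpa [hLn] using h2
    _ = _ := by simp [mul_assoc]

lemma ae_enorm_fderiv_le (hd : 1 ≤ d) {f : Ed d → Ed m} {Ψ : Ed d → ℝ≥0∞} (hΨ : Measurable Ψ)
    (h : ∀ x y, ‖f x - f y‖ₑ ≤ ‖x - y‖ₑ * (Ψ x + Ψ y)) :
    ∀ᵐ x, ‖fderiv ℝ f x‖ₑ ≤ 2 * m * Ψ x := by
  have key : ∀ q : ℚ, ∀ᵐ x, x ∈ {x | Ψ x ≤ (Real.toNNReal q : ℝ≥0∞)} ∩ {x | DifferentiableAt ℝ f x} →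
      ‖fderiv ℝ f x‖ ≤ m * (2 * Real.toNNReal q : NNReal) := by
    intro q
    refine ae_norm_fderiv_le_of_lipschitz_on hd ((hΨ measurableSet_Iic).inter
      (measurableSet_of_differentiableAt ℝ f)) (fun x hx => hx.2) fun x hx y hy => ?_
    have h1 : ‖f x - f y‖ₑ ≤ ‖x - y‖ₑ * ((Real.toNNReal q : ℝ≥0∞) + Real.toNNReal q) := by
      refine (h x y).trans ?_
      gcongr
      exacts [hx.1, hy.1]
    rw [← two_mul, mul_comm] at h1
    simp only [enorm_eq_nnnorm] at h1
    exact_mod_cast h1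
  filter_upwards [ae_all_iff.2 key] with x hx
  by_cases hdx : DifferentiableAt ℝ f x
  swap
  · rw [fderiv_zero_of_not_differentiableAt hdx]
    exact enorm_clm_zero_le _
  rcases eq_or_ne m 0 with rfl | hm
  · have : fderiv ℝ f x = 0 := by ext v j; exact j.elim0
    rw [this]
    exact enorm_clm_zero_le _
  have h2m : (2 * m : ℝ≥0∞) ≠ 0 := by simp [hm]
  have h2m' : (2 * m : ℝ≥0∞) ≠ ⊤ := by finiteness
  by_contra! hlt
  rw [mul_comm, ← ENNReal.lt_div_iff_mul_lt (Or.inl h2m) (Or.inl h2m')] at hlt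
  obtain ⟨q, -, hq1, hq2⟩ := ENNReal.lt_iff_exists_rat_btwn.1 hlt
  have h1 := hx q ⟨hq1.le, hdx⟩
  rw [ENNReal.lt_div_iff_mul_lt (Or.inl h2m) (Or.inl h2m')] at hq2
  refine hq2.not_ge ?_
  rw [enorm_eq_nnnorm]
  rw [← coe_nnnorm] at h1
  norm_cast at h1 ⊢
  exact h1.trans (le_of_eq (by push_cast; ring))

end

section

variable {d m : ℕ}

lemma enorm_gradFrobSq_smul_le (f : Ed d → Ed m) (x : Ed d) {v : Ed m} (hv : ‖v‖ = 1) :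
    ‖gradFrobSq d m f x • v‖ₑ ≤ d * (‖fderiv ℝ f x‖ₑ * ‖fderiv ℝ f x‖ₑ) := by
  have h1 : gradFrobSq d m f x ≤ d * (‖fderiv ℝ f x‖ * ‖fderiv ℝ f x‖) := by
    calc gradFrobSq d m f x ≤ ∑ _i : Fin d, ‖fderiv ℝ f x‖ * ‖fderiv ℝ f x‖ := by
          refine Finset.sum_le_sum fun i _ => ?_
          rw [← sq]
          gcongr
          simpa using (fderiv ℝ f x).le_opNorm (EuclideanSpace.single i (1 : ℝ))
      _ = _ := by simp
  have h0 : 0 ≤ gradFrobSq d m f x := Finset.sum_nonneg fun i _ => by positivity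
  rw [← ofReal_norm, norm_smul, hv, mul_one, Real.norm_of_nonneg h0, ← ofReal_norm,
    ← ENNReal.ofReal_mul (norm_nonneg _), ← ENNReal.ofReal_natCast,
    ← ENNReal.ofReal_mul (Nat.cast_nonneg _)]
  exact ENNReal.ofReal_le_ofReal h1

lemma enorm_integral_heatConv_sub_le {t : ℝ} {v : ℝ → Ed d → Ed m} {W : ℝ → Ed d → ℝ≥0∞}
    (hW : Measurable (Function.uncurry W))
    (hv : ∀ s ∈ Ioo 0 t, ∀ᵐ y, ‖v s y‖ₑ ≤ d * (W s y * W s y))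
    (hi : ∀ x, IntegrableOn (fun s => heatConv d (t - s) (v s) x) (Ioo 0 t)) (x x' : Ed d) :
    ‖(∫ s in Ioo 0 t, heatConv d (t - s) (v s) x) -
        ∫ s in Ioo 0 t, heatConv d (t - s) (v s) x'‖ₑ ≤
      ‖x - x'‖ₑ * (ENNReal.ofReal (2 ^ ((d : ℝ) / 2)) * d * heatPotential d W t x +
        ENNReal.ofReal (2 ^ ((d : ℝ) / 2)) * d * heatPotential d W t x') := by
  have hm := measurable_heatPotential_integrand hW t
  have hmx : ∀ z : Ed d, Measurable fun s : ℝ => ENNReal.ofReal ((t - s) ^ (-(1 / 2) : ℝ)) *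
      ∫⁻ y, heatKernelENN d (2 * (t - s)) (z - y) * (W s y * W s y) := fun z =>
    hm.comp (f := fun s : ℝ => (z, s)) (by fun_prop)
  rw [← integral_sub (hi x) (hi x'), ← mul_add, mul_left_comm, heatPotential, heatPotential,
    ← lintegral_add_left (hmx x), ← lintegral_const_mul' _ _ (by finiteness),
    ← lintegral_const_mul' _ _ (by finiteness)]
  refine (enorm_integral_le_lintegral_enorm _).trans ?_
  refine setLIntegral_mono' measurableSet_Ioo fun s hs => ?_
  have hτ : 0 < t - s := sub_pos.2 hs.2
  have h2 : ∀ z : Ed d, ∫⁻ y, heatKernelENN d (2 * (t - s)) (z - y) * ‖v s y‖ₑ ≤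
      d * ∫⁻ y, heatKernelENN d (2 * (t - s)) (z - y) * (W s y * W s y) := by
    intro z
    rw [← lintegral_const_mul' _ _ (by finiteness)]
    refine lintegral_mono_ae ?_
    filter_upwards [hv s hs] with y hy
    rw [mul_left_comm]
    gcongr
  refine (enorm_heatConv_sub_le hτ (v s) x x').trans ?_
  calc _ ≤ ENNReal.ofReal (2 ^ ((d : ℝ) / 2)) *
      (ENNReal.ofReal ((t - s) ^ (-(1 / 2) : ℝ)) * ‖x - x'‖ₑ *
      ((d * ∫⁻ y, heatKernelENN d (2 * (t - s)) (x - y) * (W s y * W s y)) +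
        d * ∫⁻ y, heatKernelENN d (2 * (t - s)) (x' - y) * (W s y * W s y))) := by
        gcongr
        exacts [h2 x, h2 x']
    _ = _ := by ring

lemma enorm_integral_heatConv_le {p t B : ℝ} (hp : 2 ≤ p) {v : ℝ → Ed d → Ed m}
    {W : ℝ → Ed d → ℝ≥0∞} (hW : Measurable (Function.uncurry W))
    (hv : ∀ s ∈ Ioo 0 t, ∀ᵐ y, ‖v s y‖ₑ ≤ d * (W s y * W s y)) {δ : ℝ≥0∞}
    (hδ : ∀ s ∈ Ioo 0 t, lpENN p volume (W s) ≤
      δ * ENNReal.ofReal (s ^ (-(1 / 2 - d / (2 * p)) : ℝ)))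
    (hB : ∫⁻ s in Ioo 0 t, ENNReal.ofReal ((t - s) ^ (-(d / p) : ℝ)) *
      ENNReal.ofReal (s ^ (-(1 - d / p)) : ℝ) ≤ ENNReal.ofReal B) (x : Ed d) :
    ‖∫ s in Ioo 0 t, heatConv d (t - s) (v s) x‖ₑ ≤ d * (δ * δ) * ENNReal.ofReal B := by
  have hp0 : 0 < p := by linarith
  refine (enorm_integral_le_lintegral_enorm _).trans ?_
  calc _ ≤ ∫⁻ s in Ioo 0 t, d * (δ * δ) * (ENNReal.ofReal ((t - s) ^ (-(d / p) : ℝ)) *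
      ENNReal.ofReal (s ^ (-(1 - d / p)) : ℝ)) := by
        refine setLIntegral_mono' measurableSet_Ioo fun s hs => ?_
        have hτ : 0 < t - s := sub_pos.2 hs.2
        have hWs : Measurable (W s) := hW.comp (measurable_prodMk_left (x := s))
        have hg : gaussMean d p (t - s) (W s) x ≤
            ENNReal.ofReal ((t - s) ^ (-(d / (2 * p)) : ℝ)) *
              (δ * ENNReal.ofReal (s ^ (-(1 / 2 - d / (2 * p)) : ℝ))) := by
          refine (gaussMean_le hp0 hτ _ _).trans ?_
          gcongr
          exact hδ s hs
        have e1 : ENNReal.ofReal ((t - s) ^ (-(d / p) : ℝ)) =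
            ENNReal.ofReal ((t - s) ^ (-(d / (2 * p)) : ℝ)) *
              ENNReal.ofReal ((t - s) ^ (-(d / (2 * p)) : ℝ)) := by
          rw [ofReal_rpow_mul hτ]; congr 2; field_simp; ring
        have e2 : ENNReal.ofReal (s ^ (-(1 - d / p)) : ℝ) =
            ENNReal.ofReal (s ^ (-(1 / 2 - d / (2 * p)) : ℝ)) *
              ENNReal.ofReal (s ^ (-(1 / 2 - d / (2 * p)) : ℝ)) := by
          rw [ofReal_rpow_mul hs.1]; congr 2; field_simp; ring
        calc ‖heatConv d (t - s) (v s) x‖ₑ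
            ≤ ∫⁻ y, heatKernelENN d (t - s) (x - y) * ‖v s y‖ₑ := enorm_heatConv_le hτ _ _
          _ ≤ ∫⁻ y, d * (heatKernelENN d (t - s) (x - y) * (W s y * W s y)) := by
              refine lintegral_mono_ae ?_
              filter_upwards [hv s hs] with y hy
              rw [← mul_left_comm]
              gcongr
          _ = d * ∫⁻ y, heatKernelENN d (t - s) (x - y) * (W s y * W s y) :=
              lintegral_const_mul' _ _ (by finiteness)
          _ ≤ d * ((ENNReal.ofReal ((t - s) ^ (-(d / (2 * p)) : ℝ)) *
              (δ * ENNReal.ofReal (s ^ (-(1 / 2 - d / (2 * p)) : ℝ)))) *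
              (ENNReal.ofReal ((t - s) ^ (-(d / (2 * p)) : ℝ)) *
              (δ * ENNReal.ofReal (s ^ (-(1 / 2 - d / (2 * p)) : ℝ))))) := by
              gcongr
              exact (lintegral_heatKernelENN_mul_mul_le hp hτ hWs hWs x).trans (by gcongr)
          _ = _ := by rw [e1, e2]; ring
    _ = d * (δ * δ) * ∫⁻ s in Ioo 0 t, ENNReal.ofReal ((t - s) ^ (-(d / p) : ℝ)) *
      ENNReal.ofReal (s ^ (-(1 - d / p)) : ℝ) := lintegral_const_mul _ (by fun_prop)
    _ ≤ _ := by gcongr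

end

section

variable {d m : ℕ}

open scoped RealInnerProductSpace

lemma inner_integral_nonneg {α E : Type*} [MeasurableSpace α] {μ : Measure α}
    [NormedAddCommGroup E] [InnerProductSpace ℝ E] [CompleteSpace E] {f : α → E} (e : E)
    (h : ∀ᵐ a ∂μ, 0 ≤ ⟪e, f a⟫) : 0 ≤ ⟪e, ∫ a, f a ∂μ⟫ := by
  by_cases hf : Integrable f μ
  · rw [← integral_inner hf]
    exact integral_nonneg_of_ae h
  · simp [integral_undef hf]

lemma integrable_heatKernel_smul {t : ℝ} (ht : 0 < t) {v : Ed d → Ed m}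
    (hv : AEStronglyMeasurable v volume) (hv1 : ∀ y, ‖v y‖ = 1) (x : Ed d) :
    Integrable fun y => heatKernel d t (x - y) • v y := by
  refine ((integrable_heatKernel ht).comp_sub_left x).mono
    (aestronglyMeasurable_heatKernel_smul hv x) (Eventually.of_forall fun y => ?_)
  rw [norm_smul, hv1, mul_one]

lemma ae_eq_heatConv_of_norm_eq_one {t : ℝ} (ht : 0 < t) {v : Ed d → Ed m}
    (hv1 : ∀ y, ‖v y‖ = 1) {x : Ed d} (h : ‖heatConv d t v x‖ = 1) :
    ∀ᵐ y, v y = heatConv d t v x := by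
  have hv : AEStronglyMeasurable v volume := by
    by_contra hv
    simp [heatConv_eq_zero ht hv] at h
  set e := heatConv d t v x with he
  have hi := integrable_heatKernel_smul ht hv hv1 x
  have hK : Integrable fun y => heatKernel d t (x - y) :=
    (integrable_heatKernel ht).comp_sub_left x
  have h0 : ∫ y, (heatKernel d t (x - y) - ⟪e, heatKernel d t (x - y) • v y⟫) = 0 := by
    rw [integral_sub hK (hi.const_inner e), integral_inner hi,
      integral_sub_left_eq_self (heatKernel d t) volume x, integral_heatKernel ht]
    change 1 - ⟪e, e⟫ = 0
    rw [real_inner_self_eq_norm_sq, h]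
    norm_num
  have hnn : ∀ y, 0 ≤ heatKernel d t (x - y) - ⟪e, heatKernel d t (x - y) • v y⟫ := by
    intro y
    have h1 : ⟪e, v y⟫ ≤ 1 := by simpa [h, hv1] using real_inner_le_norm e (v y)
    rw [real_inner_smul_right]
    nlinarith [heatKernel_nonneg ht (x - y)]
  rw [integral_eq_zero_iff_of_nonneg hnn (hK.sub (hi.const_inner e))] at h0
  filter_upwards [h0] with y hy
  rw [Pi.zero_apply, real_inner_smul_right] at hy
  have h2 : ⟪e, v y⟫ = 1 := by
    have h3 := heatKernel_pos ht (x - y)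
    have h4 : heatKernel d t (x - y) * (1 - ⟪e, v y⟫) = 0 := by linarith
    rcases mul_eq_zero.1 h4 with h5 | h5
    · exact absurd h5 h3.ne'
    · linarith
  exact ((inner_eq_one_iff_of_norm_eq_one h (hv1 y)).1 h2).symm

lemma heatConv_of_ae_eq_const {t : ℝ} (ht : 0 < t) {v : Ed d → Ed m} {e : Ed m}
    (hv : ∀ᵐ y, v y = e) (x : Ed d) : heatConv d t v x = e := by
  have h1 : heatConv d t v x = ∫ y, heatKernel d t (x - y) • e := by
    apply integral_congr_ae
    filter_upwards [hv] with y hy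
    rw [hy]
  rw [h1, integral_smul_const, integral_sub_left_eq_self (heatKernel d t) volume x,
    integral_heatKernel ht, one_smul]

/-- Sphere-valued mild solutions of the harmonic map heat flow with initial datum `u₀`. -/
structure IsMildSphereFlow (d m : ℕ) (u₀ : Ed d → Ed m) (u : ℝ → Ed d → Ed m) : Prop where
  norm_init : ∀ x, ‖u₀ x‖ = 1
  norm_eq : ∀ t, 0 < t → ∀ x, ‖u t x‖ = 1
  duhamel : ∀ t, 0 < t → ∀ x, u t x = heatConv d t u₀ x +
    ∫ s in Ioo 0 t, heatConv d (t - s) (fun y => gradFrobSq d m (u s) y • u s y) x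

variable {u₀ : Ed d → Ed m} {u : ℝ → Ed d → Ed m}

/-- If the heat extension of the datum has norm one somewhere, the flow is constant as long as it
stays close to the heat extension. -/
lemma IsMildSphereFlow.eq_of_norm_heatConv_eq_one (hu : IsMildSphereFlow d m u₀ u) {t : ℝ}
    (ht : 0 < t) (hclose : ∀ s ∈ Ioo 0 t, ∀ x, ‖u s x - heatConv d s u₀ x‖ < 1) {x₀ : Ed d}
    (h : ‖heatConv d t u₀ x₀‖ = 1) (x : Ed d) : u t x = heatConv d t u₀ x₀ := by
  have hae := ae_eq_heatConv_of_norm_eq_one ht hu.norm_init h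
  set e := heatConv d t u₀ x₀
  have hpos : ∀ s ∈ Ioo 0 t, ∀ y, 0 ≤ ⟪e, u s y⟫ := by
    intro s hs y
    have h1 := hclose s hs y
    rw [heatConv_of_ae_eq_const hs.1 hae] at h1
    have h2 := norm_sub_sq_real (u s y) e
    rw [hu.norm_eq s hs.1, h, real_inner_comm] at h2
    nlinarith [norm_nonneg (u s y - e)]
  have h3 : 0 ≤ ⟪e, ∫ s in Ioo 0 t,
      heatConv d (t - s) (fun y => gradFrobSq d m (u s) y • u s y) x⟫ := by
    refine inner_integral_nonneg e ((ae_restrict_iff' measurableSet_Ioo).2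
      (Eventually.of_forall fun s hs => ?_))
    refine inner_integral_nonneg e (Eventually.of_forall fun y => ?_)
    rw [real_inner_smul_right, real_inner_smul_right]
    have h4 : 0 ≤ gradFrobSq d m (u s) y := Finset.sum_nonneg fun i _ => by positivity
    exact mul_nonneg (heatKernel_nonneg (sub_pos.2 hs.2) _) (mul_nonneg h4 (hpos s hs y))
  have h5 : 1 ≤ ⟪e, u t x⟫ := by
    rw [hu.duhamel t ht x, inner_add_right, heatConv_of_ae_eq_const ht hae,
      real_inner_self_eq_norm_sq, h]
    linarith
  have h6 : ⟪e, u t x⟫ ≤ 1 := by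
    simpa [h, hu.norm_eq t ht] using real_inner_le_norm e (u t x)
  exact ((inner_eq_one_iff_of_norm_eq_one h (hu.norm_eq t ht x)).1 (le_antisymm h6 h5)).symm

lemma IsMildSphereFlow.ae_enorm_fderiv_le (hd : 1 ≤ d) (hu : IsMildSphereFlow d m u₀ u) {t : ℝ}
    (ht : 0 < t) (hclose : ∀ s ∈ Ioo 0 t, ∀ x, ‖u s x - heatConv d s u₀ x‖ < 1)
    {W : ℝ → Ed d → ℝ≥0∞} (hW : Measurable (Function.uncurry W))
    (hWu : ∀ s ∈ Ioo 0 t, W s =ᵐ[volume] fun x => ‖fderiv ℝ (u s) x‖ₑ) :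
    ∀ᵐ x, ‖fderiv ℝ (u t) x‖ₑ ≤ ‖fderiv ℝ (heatConv d t u₀) x‖ₑ +
      2 * m * (ENNReal.ofReal (2 ^ ((d : ℝ) / 2)) * d) * heatPotential d W t x := by
  by_cases hex : ∃ x₀, ‖heatConv d t u₀ x₀‖ = 1
  · obtain ⟨x₀, hx₀⟩ := hex
    have hc : u t = fun _ => heatConv d t u₀ x₀ :=
      funext fun x => hu.eq_of_norm_heatConv_eq_one ht hclose hx₀ x
    refine Eventually.of_forall fun x => ?_
    rw [hc, fderiv_fun_const]
    exact enorm_clm_zero_le _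
  push Not at hex
  have hi : ∀ x, IntegrableOn
      (fun s => heatConv d (t - s) (fun y => gradFrobSq d m (u s) y • u s y) x) (Ioo 0 t) := by
    intro x
    by_contra hx
    apply hex x
    have h1 := hu.duhamel t ht x
    rw [integral_undef hx, add_zero] at h1
    rw [← h1, hu.norm_eq t ht]
  have hv : ∀ s ∈ Ioo 0 t, ∀ᵐ y, ‖gradFrobSq d m (u s) y • u s y‖ₑ ≤ d * (W s y * W s y) := by
    intro s hs
    filter_upwards [hWu s hs] with y hy
    rw [hy]
    exact enorm_gradFrobSq_smul_le _ _ (hu.norm_eq s hs.1 y)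
  have hlip := enorm_integral_heatConv_sub_le hW hv hi
  filter_upwards [_root_.ae_enorm_fderiv_le hd
    ((measurable_heatPotential hW t).const_mul (ENNReal.ofReal (2 ^ ((d : ℝ) / 2)) * d)) hlip]
    with x hx
  rw [mul_assoc (2 * (m : ℝ≥0∞))]
  refine le_trans ?_ (add_le_add_right hx _)
  by_cases hdx : DifferentiableAt ℝ (u t) x
  swap
  · rw [fderiv_zero_of_not_differentiableAt hdx]
    exact enorm_clm_zero_le _
  have hG := differentiable_heatConv ht hu.norm_init x
  have hI : DifferentiableAt ℝ (fun x => ∫ s in Ioo 0 t,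
      heatConv d (t - s) (fun y => gradFrobSq d m (u s) y • u s y) x) x := by
    refine (hdx.sub hG).congr_of_eventuallyEq (Eventually.of_forall fun z => ?_)
    rw [Pi.sub_apply, hu.duhamel t ht z, add_sub_cancel_left]
  have he : u t = heatConv d t u₀ + fun x => ∫ s in Ioo 0 t,
      heatConv d (t - s) (fun y => gradFrobSq d m (u s) y • u s y) x :=
    funext fun z => hu.duhamel t ht z
  have h2 := congrArg (fun f => fderiv ℝ f x) he
  simp only [fderiv_add hG hI] at h2
  rw [h2]
  exact enorm_clm_add_le _ _

end

section

variable {d m : ℕ}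

/-- The constant `B` bounds the three Beta-type time integrals that occur in the estimates. -/
def BetaBound (d : ℕ) (p B : ℝ) : Prop := ∀ t : ℝ, 0 < t →
  ∫⁻ s in Ioo 0 t, ENNReal.ofReal ((t - s) ^ (-(1 / 2 + d / (2 * p)) : ℝ)) *
    ENNReal.ofReal (s ^ (-(1 - d / (2 * p)) : ℝ)) ≤
      ENNReal.ofReal B * ENNReal.ofReal (t ^ (-(1 / 2) : ℝ)) ∧
  ∫⁻ s in Ioo 0 t, ENNReal.ofReal ((t - s) ^ (-(1 / 2 + d / (2 * p)) : ℝ)) *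
    ENNReal.ofReal (s ^ (-(1 - d / p)) : ℝ) ≤
      ENNReal.ofReal B * ENNReal.ofReal (t ^ (-(1 / 2 - d / (2 * p)) : ℝ)) ∧
  ∫⁻ s in Ioo 0 t, ENNReal.ofReal ((t - s) ^ (-(d / p) : ℝ)) *
    ENNReal.ofReal (s ^ (-(1 - d / p)) : ℝ) ≤ ENNReal.ofReal B

lemma exists_betaBound (hd : 1 ≤ d) {p : ℝ} (hp : (d : ℝ) < p) : ∃ B, 0 < B ∧ BetaBound d p B := by
  have hd0 : (0 : ℝ) < d := by exact_mod_cast hd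
  have hp0 : 0 < p := hd0.trans hp
  have h1 : 0 < d / p := by positivity
  have h2 : d / p < 1 := (div_lt_one hp0).2 hp
  have h3 : d / (2 * p) = d / p / 2 := by field_simp
  obtain ⟨B₁, hB₁, H₁⟩ := exists_lintegral_beta_le (a := 1 / 2 + d / (2 * p))
    (b := 1 - d / (2 * p)) (by linarith) (by linarith) (by linarith) (by linarith)
  obtain ⟨B₂, hB₂, H₂⟩ := exists_lintegral_beta_le (a := 1 / 2 + d / (2 * p))
    (b := 1 - d / p) (by linarith) (by linarith) (by linarith) (by linarith)
  obtain ⟨B₃, hB₃, H₃⟩ := exists_lintegral_beta_le (a := d / p)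
    (b := 1 - d / p) (by linarith) (by linarith) (by linarith) (by linarith)
  refine ⟨B₁ + B₂ + B₃, by positivity, fun t ht => ⟨?_, ?_, ?_⟩⟩
  · refine (H₁ t ht).trans ?_
    rw [show 1 - (1 / 2 + d / (2 * p)) - (1 - d / (2 * p)) = (-(1 / 2) : ℝ) by ring]
    gcongr
    linarith
  · refine (H₂ t ht).trans ?_
    rw [show 1 - (1 / 2 + d / (2 * p)) - (1 - d / p) = (-(1 / 2 - d / (2 * p)) : ℝ) by
      rw [h3]; ring]
    gcongr
    linarith
  · refine (H₃ t ht).trans ?_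
    rw [show 1 - d / p - (1 - d / p) = 0 by ring, Real.rpow_zero, ENNReal.ofReal_one, mul_one]
    gcongr
    linarith

variable {u₀ : Ed d → Ed m} {u : ℝ → Ed d → Ed m}

/-- The constant in front of the heat potential in the pointwise gradient bound. -/
def gradConst (d m : ℕ) : ℝ≥0∞ := 2 * m * (ENNReal.ofReal (2 ^ ((d : ℝ) / 2)) * d)

lemma IsMildSphereFlow.norm_sub_heatConv_lt {p B t : ℝ} (hp : 2 ≤ p) (hB : BetaBound d p B)
    (hu : IsMildSphereFlow d m u₀ u) {W : ℝ → Ed d → ℝ≥0∞} (hW : Measurable (Function.uncurry W))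
    (hWu : ∀ s, 0 < s → W s =ᵐ[volume] fun x => ‖fderiv ℝ (u s) x‖ₑ) {δ : ℝ≥0∞}
    (hsmall : d * (δ * δ) * ENNReal.ofReal B < 1)
    (hδ : ∀ s ∈ Ioo 0 t, lpENN p volume (W s) ≤
      δ * ENNReal.ofReal (s ^ (-(1 / 2 - d / (2 * p)) : ℝ))) :
    ∀ s ∈ Ioo 0 t, ∀ x, ‖u s x - heatConv d s u₀ x‖ < 1 := by
  intro s hs x
  rw [hu.duhamel s hs.1, add_sub_cancel_left]
  have hv : ∀ r ∈ Ioo 0 s, ∀ᵐ y, ‖gradFrobSq d m (u r) y • u r y‖ₑ ≤ d * (W r y * W r y) := by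
    intro r hr
    filter_upwards [hWu r hr.1] with y hy
    rw [hy]
    exact enorm_gradFrobSq_smul_le _ _ (hu.norm_eq r hr.1 y)
  have h1 := enorm_integral_heatConv_le hp hW hv (fun r hr => hδ r ⟨hr.1, hr.2.trans hs.2⟩)
    (hB s hs.1).2.2 x
  have h2 := h1.trans_lt hsmall
  rw [← ofReal_norm, ENNReal.ofReal_lt_one] at h2
  exact h2

lemma IsMildSphereFlow.ae_le_heatPotential {p B t : ℝ} (hd : 1 ≤ d) (hp : 2 ≤ p) (ht : 0 < t)
    (hB : BetaBound d p B)
    (hu : IsMildSphereFlow d m u₀ u) {W : ℝ → Ed d → ℝ≥0∞} (hW : Measurable (Function.uncurry W))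
    (hWu : ∀ s, 0 < s → W s =ᵐ[volume] fun x => ‖fderiv ℝ (u s) x‖ₑ) {δ : ℝ≥0∞}
    (hsmall : d * (δ * δ) * ENNReal.ofReal B < 1)
    (hδ : ∀ s ∈ Ioo 0 t, lpENN p volume (W s) ≤
      δ * ENNReal.ofReal (s ^ (-(1 / 2 - d / (2 * p)) : ℝ))) :
    ∀ᵐ x, W t x ≤ ‖fderiv ℝ (heatConv d t u₀) x‖ₑ + gradConst d m * heatPotential d W t x := by
  filter_upwards [hWu t ht, hu.ae_enorm_fderiv_le hd ht
    (hu.norm_sub_heatConv_lt hp hB hW hWu hsmall hδ) hW fun s hs => hWu s hs.1] with x hx hx2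
  rw [hx]
  exact hx2

lemma lpENN_fderiv_heatConv_le {p t : ℝ} (hp : 0 < p) (ht : 0 < t) :
    lpENN p volume (fun x => ‖fderiv ℝ (heatConv d t u₀) x‖ₑ) ≤
      besovNorm d m p u₀ * ENNReal.ofReal (t ^ (-(1 / 2 - d / (2 * p)) : ℝ)) := by
  have h1 := le_iSup (fun t : Set.Ioi (0 : ℝ) =>
    ENNReal.ofReal ((t : ℝ) ^ ((1 : ℝ) / 2 - d / (2 * p))) *
      eLpNorm (fun x => fderiv ℝ (heatConv d (t : ℝ) u₀) x) (ENNReal.ofReal p) volume) ⟨t, ht⟩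
  calc lpENN p volume (fun x => ‖fderiv ℝ (heatConv d t u₀) x‖ₑ)
      = ENNReal.ofReal (t ^ ((1 : ℝ) / 2 - d / (2 * p))) *
          lpENN p volume (fun x => ‖fderiv ℝ (heatConv d t u₀) x‖ₑ) *
          ENNReal.ofReal (t ^ (-(1 / 2 - d / (2 * p)) : ℝ)) := by
        rw [mul_right_comm, ofReal_rpow_mul ht]; simp
    _ ≤ _ := by
        gcongr
        rw [lpENN_enorm hp]
        exact h1

lemma measurable_enorm_fderiv (f : Ed d → Ed m) : Measurable fun x => ‖fderiv ℝ f x‖ₑ := by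
  have h := (measurable_fderiv ℝ f).nnnorm
  simp only [enorm_eq_nnnorm]
  fun_prop

lemma IsMildSphereFlow.lpENN_le_of_lt {p B t : ℝ} (hd : 1 ≤ d) (hp : 2 ≤ p) (ht : 0 < t)
    (hB : BetaBound d p B)
    (hu : IsMildSphereFlow d m u₀ u) {W : ℝ → Ed d → ℝ≥0∞} (hW : Measurable (Function.uncurry W))
    (hWu : ∀ s, 0 < s → W s =ᵐ[volume] fun x => ‖fderiv ℝ (u s) x‖ₑ) {δ : ℝ≥0∞} (hδt : δ ≠ ⊤)
    (hsmall : d * (δ * δ) * ENNReal.ofReal B < 1)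
    (hsmall' : gradConst d m * δ * ENNReal.ofReal B ≤ 4⁻¹)
    (hu₀ : besovNorm d m p u₀ ≤ 4⁻¹ * δ)
    (hδ : ∀ s ∈ Ioo 0 t, lpENN p volume (W s) ≤
      δ * ENNReal.ofReal (s ^ (-(1 / 2 - d / (2 * p)) : ℝ))) :
    lpENN p volume (W t) ≤ 2⁻¹ * δ * ENNReal.ofReal (t ^ (-(1 / 2 - d / (2 * p)) : ℝ)) := by
  have hp0 : 0 < p := by linarith
  have hgc : gradConst d m ≠ ⊤ := by unfold gradConst; finiteness
  have h1 : ∀ x, heatPotential d W t x ≤ δ * gaussPotential d p W t x := by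
    intro x
    simpa using heatPotential_le (A := 0) hp hW hW hδ (fun s _ y => by simp) x
  have h2 : lpENN p volume (heatPotential d W t) ≤
      δ * (ENNReal.ofReal B * ENNReal.ofReal (t ^ (-(1 / 2 - d / (2 * p)) : ℝ)) * δ) := by
    refine (lpENN_mono hp0 (Eventually.of_forall h1)).trans ?_
    rw [lpENN_const_mul hp0 hδt]
    gcongr
    exact lpENN_gaussPotential_le hp hW (hB t ht).2.1 hδ
  calc lpENN p volume (W t) ≤ lpENN p volume (fun x => ‖fderiv ℝ (heatConv d t u₀) x‖ₑ +
        gradConst d m * heatPotential d W t x) :=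
        lpENN_mono hp0 (hu.ae_le_heatPotential hd hp ht hB hW hWu hsmall hδ)
    _ ≤ lpENN p volume (fun x => ‖fderiv ℝ (heatConv d t u₀) x‖ₑ) +
        lpENN p volume (fun x => gradConst d m * heatPotential d W t x) :=
        lpENN_add_le (by linarith) (measurable_enorm_fderiv _).aemeasurable
          ((measurable_heatPotential hW t).const_mul _).aemeasurable
    _ ≤ 4⁻¹ * δ * ENNReal.ofReal (t ^ (-(1 / 2 - d / (2 * p)) : ℝ)) + gradConst d m *
        (δ * (ENNReal.ofReal B * ENNReal.ofReal (t ^ (-(1 / 2 - d / (2 * p)) : ℝ)) * δ)) := by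
        rw [lpENN_const_mul hp0 hgc]
        gcongr
        exact (lpENN_fderiv_heatConv_le hp0 ht).trans (by gcongr)
    _ = 4⁻¹ * δ * ENNReal.ofReal (t ^ (-(1 / 2 - d / (2 * p)) : ℝ)) +
        (gradConst d m * δ * ENNReal.ofReal B) *
          (δ * ENNReal.ofReal (t ^ (-(1 / 2 - d / (2 * p)) : ℝ))) := by ring
    _ ≤ 4⁻¹ * δ * ENNReal.ofReal (t ^ (-(1 / 2 - d / (2 * p)) : ℝ)) +
        4⁻¹ * (δ * ENNReal.ofReal (t ^ (-(1 / 2 - d / (2 * p)) : ℝ))) := by gcongr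
    _ = _ := by
        rw [mul_assoc, ← add_mul, mul_assoc]
        congr 1
        rw [← ENNReal.toReal_eq_toReal_iff' (by finiteness) (by finiteness),
          ENNReal.toReal_add (by finiteness) (by finiteness)]
        norm_num

lemma le_of_continuous_bootstrap {N : ℝ → ℝ} (hN : Continuous N) (hN0 : N 0 = 0) {δ : ℝ}
    (hδ : 0 < δ) (h : ∀ t, 0 < t → (∀ s ∈ Ioo 0 t, N s ≤ δ) → N t < δ) {t : ℝ} (ht : 0 < t) :
    N t ≤ δ := by
  by_contra! hlt
  set S := {s | 0 ≤ s ∧ δ ≤ N s} with hS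
  have hSc : IsClosed S :=
    (isClosed_le continuous_const continuous_id).inter (isClosed_le continuous_const hN)
  have hSb : BddBelow S := ⟨0, fun s hs => hs.1⟩
  have hT := hSc.csInf_mem ⟨t, ht.le, hlt.le⟩ hSb
  have hT0 : 0 < sInf S := by
    refine lt_of_le_of_ne hT.1 fun h0 => ?_
    have := hT.2
    rw [← h0, hN0] at this
    linarith
  refine (h _ hT0 fun s hs => ?_).not_ge hT.2
  by_contra! hlt
  exact (csInf_le hSb ⟨hs.1.le, hlt.le⟩).not_gt hs.2

end

section

variable {d m : ℕ} {u₀ : Ed d → Ed m} {u : ℝ → Ed d → Ed m}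

lemma IsMildSphereFlow.lpENN_excess_le {p B : ℝ} (hd : 1 ≤ d) (hp : 2 ≤ p)
    (hB : BetaBound d p B)
    (hu : IsMildSphereFlow d m u₀ u) {W : ℝ → Ed d → ℝ≥0∞} (hW : Measurable (Function.uncurry W))
    (hWu : ∀ s, 0 < s → W s =ᵐ[volume] fun x => ‖fderiv ℝ (u s) x‖ₑ) {δ : ℝ≥0∞} (hδt : δ ≠ ⊤)
    (hsmall : d * (δ * δ) * ENNReal.ofReal B < 1)
    (hsmall' : gradConst d m * δ * ENNReal.ofReal B ≤ 4⁻¹)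
    (hδ : ∀ s, 0 < s → lpENN p volume (W s) ≤
      δ * ENNReal.ofReal (s ^ (-(1 / 2 - d / (2 * p)) : ℝ))) {C A : ℝ≥0∞} (hA : A = 2 * C)
    (hC : ∀ s, 0 < s → ∀ x, ‖fderiv ℝ (heatConv d s u₀) x‖ₑ ≤
      C * ENNReal.ofReal (s ^ (-(1 / 2) : ℝ))) {η : ℝ≥0∞}
    (hη : ∀ s, 0 < s →
      lpENN p volume (fun x => W s x - A * ENNReal.ofReal (s ^ (-(1 / 2) : ℝ))) ≤
      η * ENNReal.ofReal (s ^ (-(1 / 2 - d / (2 * p)) : ℝ))) {t : ℝ} (ht : 0 < t) :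
    lpENN p volume (fun x => W t x - A * ENNReal.ofReal (t ^ (-(1 / 2) : ℝ))) ≤
      4⁻¹ * η * ENNReal.ofReal (t ^ (-(1 / 2 - d / (2 * p)) : ℝ)) := by
  have hp0 : 0 < p := by linarith
  have hgc : gradConst d m ≠ ⊤ := by unfold gradConst; finiteness
  set b : ℝ → Ed d → ℝ≥0∞ := fun s x => W s x - A * ENNReal.ofReal (s ^ (-(1 / 2) : ℝ))
  have hb : Measurable (Function.uncurry b) := Measurable.sub hW (by fun_prop)
  have h1 : ∀ x, heatPotential d W t x ≤
      δ * (A * (ENNReal.ofReal B * ENNReal.ofReal (t ^ (-(1 / 2) : ℝ)))) +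
        δ * gaussPotential d p b t x := by
    intro x
    refine (heatPotential_le (A := A) (b := b) hp hW hb (fun s hs => hδ s hs.1)
      (fun s _ y => le_add_tsub) x).trans ?_
    gcongr
    exact (hB t ht).1
  have hquarter : (2 * 4⁻¹ : ℝ≥0∞) ≤ 1 := by
    rw [← ENNReal.toReal_le_toReal (by finiteness) (by finiteness)]
    norm_num
  have h2 : ∀ᵐ x, b t x ≤ gradConst d m * δ * gaussPotential d p b t x := by
    filter_upwards [hu.ae_le_heatPotential hd hp ht hB hW hWu hsmall fun s hs => hδ s hs.1]
      with x hx
    refine tsub_le_iff_left.2 ?_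
    calc W t x ≤ C * ENNReal.ofReal (t ^ (-(1 / 2) : ℝ)) + gradConst d m *
          (δ * (A * (ENNReal.ofReal B * ENNReal.ofReal (t ^ (-(1 / 2) : ℝ)))) +
            δ * gaussPotential d p b t x) := by
          refine hx.trans ?_
          gcongr
          exacts [hC t ht x, h1 x]
      _ = C * ENNReal.ofReal (t ^ (-(1 / 2) : ℝ)) + (gradConst d m * δ * ENNReal.ofReal B) *
          (A * ENNReal.ofReal (t ^ (-(1 / 2) : ℝ))) +
            gradConst d m * δ * gaussPotential d p b t x := by ring
      _ ≤ C * ENNReal.ofReal (t ^ (-(1 / 2) : ℝ)) + 4⁻¹ *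
          (A * ENNReal.ofReal (t ^ (-(1 / 2) : ℝ))) +
            gradConst d m * δ * gaussPotential d p b t x := by gcongr
      _ = C * ENNReal.ofReal (t ^ (-(1 / 2) : ℝ)) + (2 * 4⁻¹) *
          (C * ENNReal.ofReal (t ^ (-(1 / 2) : ℝ))) +
            gradConst d m * δ * gaussPotential d p b t x := by rw [hA]; ring
      _ ≤ C * ENNReal.ofReal (t ^ (-(1 / 2) : ℝ)) + 1 *
          (C * ENNReal.ofReal (t ^ (-(1 / 2) : ℝ))) +
            gradConst d m * δ * gaussPotential d p b t x := by gcongr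
      _ = _ := by rw [hA]; ring
  calc lpENN p volume (b t)
      ≤ lpENN p volume (fun x => gradConst d m * δ * gaussPotential d p b t x) :=
        lpENN_mono hp0 h2
    _ = gradConst d m * δ * lpENN p volume (gaussPotential d p b t) :=
        lpENN_const_mul hp0 (by finiteness) _
    _ ≤ gradConst d m * δ * (ENNReal.ofReal B *
        ENNReal.ofReal (t ^ (-(1 / 2 - d / (2 * p)) : ℝ)) * η) := by
        gcongr
        exact lpENN_gaussPotential_le hp hb (hB t ht).2.1 fun s hs => hη s hs.1
    _ = (gradConst d m * δ * ENNReal.ofReal B) * η *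
        ENNReal.ofReal (t ^ (-(1 / 2 - d / (2 * p)) : ℝ)) := by ring
    _ ≤ _ := by gcongr

lemma IsMildSphereFlow.ae_le_rpow {p B : ℝ} (hd : 1 ≤ d) (hp : 2 ≤ p)
    (hB : BetaBound d p B)
    (hu : IsMildSphereFlow d m u₀ u) {W : ℝ → Ed d → ℝ≥0∞} (hW : Measurable (Function.uncurry W))
    (hWu : ∀ s, 0 < s → W s =ᵐ[volume] fun x => ‖fderiv ℝ (u s) x‖ₑ) {δ : ℝ≥0∞} (hδt : δ ≠ ⊤)
    (hsmall : d * (δ * δ) * ENNReal.ofReal B < 1)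
    (hsmall' : gradConst d m * δ * ENNReal.ofReal B ≤ 4⁻¹)
    (hδ : ∀ s, 0 < s → lpENN p volume (W s) ≤
      δ * ENNReal.ofReal (s ^ (-(1 / 2 - d / (2 * p)) : ℝ))) {C : ℝ≥0∞}
    (hC : ∀ s, 0 < s → ∀ x, ‖fderiv ℝ (heatConv d s u₀) x‖ₑ ≤
      C * ENNReal.ofReal (s ^ (-(1 / 2) : ℝ))) {t : ℝ} (ht : 0 < t) :
    ∀ᵐ x, W t x ≤ 2 * C * ENNReal.ofReal (t ^ (-(1 / 2) : ℝ)) := by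
  have hp0 : 0 < p := by linarith
  have key : ∀ n : ℕ, ∀ s, 0 < s →
      lpENN p volume (fun x => W s x - 2 * C * ENNReal.ofReal (s ^ (-(1 / 2) : ℝ))) ≤
      4⁻¹ ^ n * δ * ENNReal.ofReal (s ^ (-(1 / 2 - d / (2 * p)) : ℝ)) := by
    intro n
    induction n with
    | zero =>
      intro s hs
      rw [pow_zero, one_mul]
      exact (lpENN_mono hp0 (Eventually.of_forall fun x => tsub_le_self)).trans (hδ s hs)
    | succ n ih =>
      intro s hs
      rw [pow_succ', mul_assoc 4⁻¹]
      exact hu.lpENN_excess_le hd hp hB hW hWu hδt hsmall hsmall' hδ rfl hC ih hs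
  have h0 : lpENN p volume (fun x => W t x - 2 * C * ENNReal.ofReal (t ^ (-(1 / 2) : ℝ))) = 0 := by
    have hlim : Tendsto (fun n : ℕ => (4⁻¹ : ℝ≥0∞) ^ n * (δ *
        ENNReal.ofReal (t ^ (-(1 / 2 - d / (2 * p)) : ℝ)))) atTop (nhds (0 * (δ *
        ENNReal.ofReal (t ^ (-(1 / 2 - d / (2 * p)) : ℝ))))) :=
      ENNReal.Tendsto.mul_const
        (ENNReal.tendsto_pow_atTop_nhds_zero_of_lt_one (by simp))
        (Or.inr (by finiteness))
    rw [zero_mul] at hlim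
    refine le_antisymm (ge_of_tendsto' hlim fun n => ?_) zero_le
    rw [← mul_assoc]
    exact key n t ht
  have hWt : Measurable (W t) := hW.comp (measurable_prodMk_left (x := t))
  rw [lpENN, ENNReal.rpow_eq_zero_iff_of_pos (by positivity),
    lintegral_eq_zero_iff ((hWt.sub_const _).pow_const _)] at h0
  filter_upwards [h0] with x hx
  rw [Pi.zero_apply, ENNReal.rpow_eq_zero_iff_of_pos hp0] at hx
  exact tsub_eq_zero_iff_le.1 hx

end

section

variable {d m : ℕ}

/-- The constant in the bound of the parabolic cylinder norm by a weighted `L^p` norm. -/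
def cylinderConst (d : ℕ) (p : ℝ) : ℝ≥0∞ :=
  volume (Metric.ball (0 : Ed d) 1) ^ (1 / 2 - 1 / p) * ENNReal.ofReal (d / p)⁻¹ ^ (1 / 2 : ℝ)

lemma ofReal_rpow_mul_cylinderL2_le {F : Type} [NormedAddCommGroup F] (hd : 1 ≤ d) {p : ℝ}
    (hp2 : 2 ≤ p) {w : ℝ → Ed d → F} {M : ℝ≥0∞}
    (hw : ∀ s, 0 < s → Measurable fun y => ‖w s y‖ₑ)
    (hM : ∀ s, 0 < s → lpENN p volume (fun y => ‖w s y‖ₑ) ≤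
      M * ENNReal.ofReal (s ^ (-(1 / 2 - d / (2 * p)) : ℝ))) (x : Ed d) {R : ℝ} (hR : 0 < R) :
    ENNReal.ofReal (R ^ (-(d : ℝ) / 2)) * cylinderL2 d w x R ≤ M * cylinderConst d p := by
  have hp0 : 0 < p := by linarith
  have hd0 : (0 : ℝ) < d := by exact_mod_cast hd
  have hpi : (0 : ℝ) ≤ 1 / 2 - 1 / p := sub_nonneg.2 (one_div_le_one_div_of_le (by norm_num) hp2)
  set c := volume (Metric.ball (0 : Ed d) 1) ^ (1 / 2 - 1 / p) with hc
  have hvol : volume (Metric.ball x R) ^ (1 / 2 - 1 / p) =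
      c * ENNReal.ofReal (R ^ (d / 2 - d / p : ℝ)) := by
    rw [Measure.addHaar_ball_of_pos _ _ hR, finrank_euclideanSpace_fin,
      ENNReal.mul_rpow_of_nonneg _ _ hpi, mul_comm, ENNReal.ofReal_rpow_of_nonneg (by positivity) hpi,
      ← Real.rpow_natCast, ← Real.rpow_mul hR.le]
    congr 3
    field_simp
  have hin : ∀ s ∈ Ioo 0 (R ^ 2), ∫⁻ y in Metric.ball x R, ‖w s y‖ₑ ^ (2 : ℝ) ≤
      (M * (c * ENNReal.ofReal (R ^ (d / 2 - d / p : ℝ)))) ^ (2 : ℝ) *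
        ENNReal.ofReal (s ^ (-(1 - d / p) : ℝ)) := by
    intro s hs
    have h1 : lpENN 2 (volume.restrict (Metric.ball x R)) (fun y => ‖w s y‖ₑ) ≤
        M * ENNReal.ofReal (s ^ (-(1 / 2 - d / (2 * p)) : ℝ)) *
          (c * ENNReal.ofReal (R ^ (d / 2 - d / p : ℝ))) := by
      refine (lpENN_one_le two_pos hp2 (hw s hs.1).aemeasurable).trans ?_
      rw [Measure.restrict_apply_univ, hvol]
      gcongr
      refine le_trans ?_ (hM s hs.1)
      unfold lpENN
      gcongr
      exact Measure.restrict_le_self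
    rw [lpENN_le_iff two_pos] at h1
    refine h1.trans (le_of_eq ?_)
    rw [mul_right_comm, ENNReal.mul_rpow_of_nonneg _ _ two_pos.le,
      ENNReal.ofReal_rpow_of_nonneg (Real.rpow_nonneg hs.1.le _) two_pos.le,
      ← Real.rpow_mul hs.1.le]
    congr 3
    field_simp
  have hcyl : cylinderL2 d w x R ≤ M * (c * ENNReal.ofReal (R ^ (d / 2 - d / p : ℝ))) *
      (ENNReal.ofReal (R ^ (d / p : ℝ)) * ENNReal.ofReal (d / p)⁻¹ ^ (1 / 2 : ℝ)) := by
    have h2 := lpENN_enorm (μ := ((volume : Measure ℝ).restrict (Ioo 0 (R ^ 2))).prod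
      ((volume : Measure (Ed d)).restrict (Metric.ball x R))) two_pos fun q => w q.1 q.2
    rw [ENNReal.ofReal_ofNat] at h2
    rw [cylinderL2, ← h2, lpENN_le_iff two_pos]
    refine (lintegral_prod_le _).trans ?_
    refine (setLIntegral_mono' measurableSet_Ioo hin).trans ?_
    rw [lintegral_const_mul _ (by fun_prop), lintegral_Ioo_rpow (by positivity)
      (by linarith [div_pos hd0 hp0])]
    refine le_of_eq ?_
    conv_rhs => rw [ENNReal.mul_rpow_of_nonneg _ _ two_pos.le]
    congr 1
    conv_rhs => rw [ENNReal.mul_rpow_of_nonneg _ _ two_pos.le, ← ENNReal.rpow_mul,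
      ENNReal.ofReal_rpow_of_nonneg (by positivity) two_pos.le, ← Real.rpow_mul hR.le,
      show (1 / 2 : ℝ) * 2 = 1 by norm_num, ENNReal.rpow_one, ← ENNReal.ofReal_mul (by positivity)]
    rw [sub_sub_cancel, div_eq_mul_inv, ← Real.rpow_natCast, ← Real.rpow_mul hR.le]
    congr 3
    push_cast
    ring
  calc _ ≤ ENNReal.ofReal (R ^ (-(d : ℝ) / 2)) * (M * (c * ENNReal.ofReal (R ^ (d / 2 - d / p : ℝ))) *
      (ENNReal.ofReal (R ^ (d / p : ℝ)) * ENNReal.ofReal (d / p)⁻¹ ^ (1 / 2 : ℝ))) := by gcongr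
    _ = M * (c * ENNReal.ofReal (d / p)⁻¹ ^ (1 / 2 : ℝ)) * (ENNReal.ofReal (R ^ (-(d : ℝ) / 2)) *
        ENNReal.ofReal (R ^ (d / 2 - d / p : ℝ)) * ENNReal.ofReal (R ^ (d / p : ℝ))) := by ring
    _ = _ := by
        rw [ofReal_rpow_mul hR, ofReal_rpow_mul hR, show
          (-(d : ℝ) / 2 + (d / 2 - d / p) + d / p) = 0 by ring, Real.rpow_zero, ENNReal.ofReal_one,
          mul_one, cylinderConst]

lemma cylinderConst_ne_top {p : ℝ} (hp2 : 2 ≤ p) : cylinderConst d p ≠ ⊤ := by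
  have hpi : (0 : ℝ) ≤ 1 / 2 - 1 / p := sub_nonneg.2 (one_div_le_one_div_of_le (by norm_num) hp2)
  exact ENNReal.mul_ne_top (ENNReal.rpow_ne_top_of_nonneg hpi measure_ball_lt_top.ne)
    (ENNReal.rpow_ne_top_of_nonneg (by norm_num) ENNReal.ofReal_ne_top)

end

section

variable {d m : ℕ} {u₀ : Ed d → Ed m} {u : ℝ → Ed d → Ed m}

lemma enorm_fderiv_sub_le {f g : Ed d → Ed m} (hg : Differentiable ℝ g) (x : Ed d) :
    ‖fderiv ℝ (fun x => f x - g x) x‖ₑ ≤ ‖fderiv ℝ f x‖ₑ + ‖fderiv ℝ g x‖ₑ := by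
  by_cases hf : DifferentiableAt ℝ f x
  · rw [fderiv_fun_sub hf (hg x)]
    simp only [enorm_eq_nnnorm]
    exact_mod_cast nnnorm_sub_le (fderiv ℝ f x) (fderiv ℝ g x)
  · rw [fderiv_zero_of_not_differentiableAt fun h =>
      hf ((h.add (hg x)).congr_of_eventuallyEq (Eventually.of_forall fun y => by simp))]
    exact enorm_clm_zero_le _

/-- Smallness of the weighted `L^p` norm of the gradient propagates from the initial time. -/
lemma IsMildSphereFlow.lpENN_le {p B : ℝ} (hd : 1 ≤ d) (hp : 2 ≤ p) (hB : BetaBound d p B)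
    (hu : IsMildSphereFlow d m u₀ u) {W : ℝ → Ed d → ℝ≥0∞} (hW : Measurable (Function.uncurry W))
    (hWu : ∀ s, 0 < s → W s =ᵐ[volume] fun x => ‖fderiv ℝ (u s) x‖ₑ) {N : ℝ → ℝ}
    (hN : Continuous N) (hN0 : N 0 = 0) (hWN : ∀ t, 0 < t → lpENN p volume (W t) =
      ENNReal.ofReal (N t) * ENNReal.ofReal (t ^ (-(1 / 2 - d / (2 * p)) : ℝ)))
    {δ : ℝ} (hδ : 0 < δ)
    (hsmall : d * (ENNReal.ofReal δ * ENNReal.ofReal δ) * ENNReal.ofReal B < 1)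
    (hsmall' : gradConst d m * ENNReal.ofReal δ * ENNReal.ofReal B ≤ 4⁻¹)
    (hu₀ : besovNorm d m p u₀ ≤ 4⁻¹ * ENNReal.ofReal δ) {t : ℝ} (ht : 0 < t) :
    lpENN p volume (W t) ≤
      ENNReal.ofReal δ * ENNReal.ofReal (t ^ (-(1 / 2 - d / (2 * p)) : ℝ)) := by
  rw [hWN t ht]
  gcongr
  refine le_of_continuous_bootstrap hN hN0 hδ (fun t ht h => ?_) ht
  have h1 := hu.lpENN_le_of_lt hd hp ht hB hW hWu ENNReal.ofReal_ne_top hsmall hsmall' hu₀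
    fun s hs => by rw [hWN s hs.1]; gcongr; exact h s hs
  have hpos : 0 < t ^ (-(1 / 2 - d / (2 * p)) : ℝ) := by positivity
  rw [hWN t ht, ENNReal.mul_le_mul_iff_left (ENNReal.ofReal_pos.2 hpos).ne' ENNReal.ofReal_ne_top,
    show (2⁻¹ : ℝ≥0∞) = ENNReal.ofReal 2⁻¹ by rw [ENNReal.ofReal_inv_of_pos two_pos]; simp,
    ← ENNReal.ofReal_mul (by norm_num), ENNReal.ofReal_le_ofReal_iff (by positivity)] at h1
  linarith

lemma Xnorm_sub_heatConv_le (hd : 1 ≤ d) {p : ℝ} (hp2 : 2 ≤ p)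
    (hu : IsMildSphereFlow d m u₀ u) {A C M M₀ : ℝ≥0∞}
    (hA : ∀ t, 0 < t → ∀ᵐ x, ‖fderiv ℝ (u t) x‖ₑ ≤ A * ENNReal.ofReal (t ^ (-(1 / 2) : ℝ)))
    (hC : ∀ t, 0 < t → ∀ x, ‖fderiv ℝ (heatConv d t u₀) x‖ₑ ≤
      C * ENNReal.ofReal (t ^ (-(1 / 2) : ℝ)))
    (hM : ∀ t, 0 < t → lpENN p volume (fun x => ‖fderiv ℝ (u t) x‖ₑ) ≤
      M * ENNReal.ofReal (t ^ (-(1 / 2 - d / (2 * p)) : ℝ)))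
    (hM₀ : besovNorm d m p u₀ ≤ M₀) :
    Xnorm d m (fun t x => u t x - heatConv d t u₀ x) ≤
      2 + (A + C) + (M + M₀) * cylinderConst d p := by
  have hp0 : 0 < p := by linarith
  have hle : ∀ t, 0 < t → ∀ x, ‖fderiv ℝ (fun x => u t x - heatConv d t u₀ x) x‖ₑ ≤
      ‖fderiv ℝ (u t) x‖ₑ + ‖fderiv ℝ (heatConv d t u₀) x‖ₑ := fun t ht =>
    enorm_fderiv_sub_le (differentiable_heatConv ht hu.norm_init)
  unfold Xnorm
  refine add_le_add (iSup_le fun ⟨t, ht⟩ => add_le_add ?_ ?_) (iSup_le fun x => iSup_le fun R => ?_)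
  · rw [eLpNorm_exponent_top]
    refine eLpNormEssSup_le_of_ae_enorm_bound (Eventually.of_forall fun x => ?_)
    refine (enorm_sub_le).trans ?_
    refine (add_le_add ?_ (enorm_heatConv_le_one ht hu.norm_init x)).trans_eq one_add_one_eq_two
    rw [← ofReal_norm, hu.norm_eq t ht x, ENNReal.ofReal_one]
  · have ht0 : 0 < t := ht
    have h1 : eLpNorm (fun x => fderiv ℝ (fun x => u t x - heatConv d t u₀ x) x) ⊤ volume ≤
        (A + C) * ENNReal.ofReal (t ^ (-(1 / 2) : ℝ)) := by
      rw [eLpNorm_exponent_top]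
      refine eLpNormEssSup_le_of_ae_enorm_bound ?_
      filter_upwards [hA t ht] with x hx
      refine (hle t ht x).trans ?_
      rw [add_mul]
      exact add_le_add hx (hC t ht x)
    calc _ ≤ ENNReal.ofReal (t ^ (1 / 2 : ℝ)) *
          ((A + C) * ENNReal.ofReal (t ^ (-(1 / 2) : ℝ))) := by gcongr
      _ = (A + C) * (ENNReal.ofReal (t ^ (1 / 2 : ℝ)) *
          ENNReal.ofReal (t ^ (-(1 / 2) : ℝ))) := by ring
      _ = A + C := by
          rw [ofReal_rpow_mul ht0, add_neg_cancel, Real.rpow_zero, ENNReal.ofReal_one, mul_one]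
  · refine ofReal_rpow_mul_cylinderL2_le hd hp2 (fun s _ => measurable_enorm_fderiv _)
      (fun s hs => ?_) x R.2
    refine (lpENN_mono hp0 (Eventually.of_forall (hle s hs))).trans ?_
    refine (lpENN_add_le (by linarith) (measurable_enorm_fderiv _).aemeasurable
      (measurable_enorm_fderiv _).aemeasurable).trans ?_
    rw [add_mul]
    exact add_le_add (hM s hs) ((lpENN_fderiv_heatConv_le hp0 hs).trans (by gcongr))

lemma exists_small (d m : ℕ) {B : ℝ} (hB : 0 < B) : ∃ δ : ℝ, 0 < δ ∧
    d * (ENNReal.ofReal δ * ENNReal.ofReal δ) * ENNReal.ofReal B < 1 ∧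
    gradConst d m * ENNReal.ofReal δ * ENNReal.ofReal B ≤ 4⁻¹ := by
  have hc : gradConst d m = ENNReal.ofReal (2 * m * (2 ^ ((d : ℝ) / 2) * d)) := by
    rw [gradConst, ENNReal.ofReal_mul (by positivity), ENNReal.ofReal_mul (by positivity),
      ENNReal.ofReal_mul (by positivity)]
    simp
  rw [hc]
  generalize hc' : (2 * m * (2 ^ ((d : ℝ) / 2) * d) : ℝ) = c
  have hc0 : 0 ≤ c := by rw [← hc']; positivity
  have hD : 0 < 1 + c * B + d * B := by positivity
  refine ⟨1 / (4 * (1 + c * B + d * B)), by positivity, ?_, ?_⟩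
  · have h4 : 1 / (4 * (1 + c * B + d * B)) ≤ 1 := by
      rw [div_le_one (by positivity)]
      nlinarith [mul_nonneg hc0 hB.le, mul_nonneg (Nat.cast_nonneg (α := ℝ) d) hB.le]
    have h5 : d * B * (1 / (4 * (1 + c * B + d * B))) < 1 := by
      rw [mul_one_div, div_lt_one (by positivity)]
      nlinarith [mul_nonneg hc0 hB.le, mul_nonneg (Nat.cast_nonneg (α := ℝ) d) hB.le]
    have h6 : 0 < 1 / (4 * (1 + c * B + d * B)) := by positivity
    generalize 1 / (4 * (1 + c * B + d * B)) = δ at *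
    rw [← ENNReal.ofReal_natCast, ← ENNReal.ofReal_mul h6.le, ← ENNReal.ofReal_mul (by positivity),
      ← ENNReal.ofReal_mul (by positivity), ENNReal.ofReal_lt_one]
    have : 0 ≤ d * B * δ := by positivity
    nlinarith
  · rw [← ENNReal.ofReal_mul hc0, ← ENNReal.ofReal_mul (by positivity),
      show (4⁻¹ : ℝ≥0∞) = ENNReal.ofReal 4⁻¹ by rw [ENNReal.ofReal_inv_of_pos (by norm_num)]; simp]
    refine ENNReal.ofReal_le_ofReal ?_
    rw [mul_one_div, div_mul_eq_mul_div, div_le_iff₀ (by positivity)]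
    nlinarith [mul_nonneg hc0 hB.le, mul_nonneg (Nat.cast_nonneg (α := ℝ) d) hB.le]

end

/-- unconditional uniqueness estimate `‖u - G(·)u₀‖_X ≤ Cε` for
sphere-valued solutions of the harmonic map heat flow with small Besov data. -/
theorem sphere_unconditional_uniqueness (d m : ℕ) (hd : 1 ≤ d) (p : ℝ)
    (hp : (d : ℝ) < p) (hp2 : 2 ≤ p) :
    ∃ ε C : ℝ, 0 < ε ∧ 0 < C ∧
      ∀ (u₀ : Ed d → Ed m) (u : ℝ → Ed d → Ed m),
        (∀ x : Ed d, ‖u₀ x‖ = 1) →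
        (∀ t : ℝ, 0 < t → ∀ x : Ed d, ‖u t x‖ = 1) →
        besovNorm d m p u₀ < ENNReal.ofReal ε →
        (∀ t : ℝ, 0 < t → ∀ x : Ed d,
          u t x = heatConv d t u₀ x +
            ∫ s in Set.Ioo (0 : ℝ) t,
              heatConv d (t - s) (fun y => gradFrobSq d m (u s) y • u s y) x) →
        GradContinuousVanishing d m p
          (le_of_lt (lt_of_le_of_lt (by exact_mod_cast hd) hp)) u →
        Xnorm d m (fun t x => u t x - heatConv d t u₀ x) ≤ ENNReal.ofReal (C * ε) := by
  obtain ⟨B, hB0, hB⟩ := exists_betaBound hd hp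
  obtain ⟨δ, hδ, hsmall, hsmall'⟩ := exists_small d m hB0
  have hp0 : 0 < p := by linarith
  have h4 : ENNReal.ofReal (δ / 4) = 4⁻¹ * ENNReal.ofReal δ := by
    rw [div_eq_inv_mul, ENNReal.ofReal_mul (by norm_num), ENNReal.ofReal_inv_of_pos (by norm_num)]
    simp
  set C₀ := ENNReal.ofReal (2 * 2 ^ ((d : ℝ) / 2)) with hC₀
  set K := 2 + (2 * C₀ + C₀) + (ENNReal.ofReal δ + ENNReal.ofReal (δ / 4)) * cylinderConst d p
    with hK
  have hKt : K ≠ ⊤ := by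
    have := cylinderConst_ne_top (d := d) hp2
    finiteness
  refine ⟨δ / 4, K.toReal / (δ / 4) + 1, by positivity, by positivity, ?_⟩
  intro u₀ u hu₀ hu hbesov hduhamel hcont
  have hflow : IsMildSphereFlow d m u₀ u := ⟨hu₀, hu, hduhamel⟩
  obtain ⟨W, N, hW, hN, hN0, hWN⟩ := hcont.exists_version
  have hWu := fun t ht => (hWN t ht).1
  have hWδ := fun t ht => hflow.lpENN_le hd hp2 hB hW hWu hN hN0 (fun t ht => (hWN t ht).2) hδ
    hsmall hsmall' (h4 ▸ hbesov.le) (t := t) ht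
  have hC : ∀ t, 0 < t → ∀ x, ‖fderiv ℝ (heatConv d t u₀) x‖ₑ ≤
      C₀ * ENNReal.ofReal (t ^ (-(1 / 2) : ℝ)) := fun t ht => enorm_fderiv_heatConv_le ht hu₀
  have hA : ∀ t, 0 < t → ∀ᵐ x, ‖fderiv ℝ (u t) x‖ₑ ≤
      2 * C₀ * ENNReal.ofReal (t ^ (-(1 / 2) : ℝ)) := by
    intro t ht
    filter_upwards [hWu t ht, hflow.ae_le_rpow hd hp2 hB hW hWu ENNReal.ofReal_ne_top hsmall
      hsmall' hWδ hC ht] with x hx hx2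
    rwa [← hx]
  have hM : ∀ t, 0 < t → lpENN p volume (fun x => ‖fderiv ℝ (u t) x‖ₑ) ≤
      ENNReal.ofReal δ * ENNReal.ofReal (t ^ (-(1 / 2 - d / (2 * p)) : ℝ)) := by
    intro t ht
    rw [← lpENN_congr hp0 (hWu t ht)]
    exact hWδ t ht
  refine (Xnorm_sub_heatConv_le hd hp2 hflow hA hC hM hbesov.le).trans ?_
  rw [ENNReal.le_ofReal_iff_toReal_le hKt (by positivity), add_mul, div_mul_cancel₀ _ (by positivity)]
  linarith
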